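/- arXiv:math/0406447 — 9 statements merged into one kernel-verified Lean document; each statement's English description precedes it below -/
import Mathlib

section
/- Let M be a q×q row-stochastic real matrix and let v be a probability row vector with vM = v and v_i > 0 for every i. Then for every vector b = (b_1,…,b_q) with b_i > 0 for all i, one has ∑_{i=1}^q v_i/(Mb)_i ≤ ∑_{i=1}^q v_i/b_i, where (Mb)_i = ∑_{j=1}^q M_{i,j} b_j. -/
/-- Jensen's inequality for `x ↦ x⁻¹` on the positive reals. -/
theorem inv_sum_mul_le_sum_mul_inv {ι : Type*} (s : Finset ι) {w b : ι → ℝ}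
    (hw : ∀ i ∈ s, 0 ≤ w i) (hw_sum : ∑ i ∈ s, w i = 1) (hb : ∀ i ∈ s, 0 < b i) :
    (∑ i ∈ s, w i * b i)⁻¹ ≤ ∑ i ∈ s, w i * (b i)⁻¹ := by
  simpa using (convexOn_zpow (𝕜 := ℝ) (-1)).map_sum_le hw hw_sum hb

/-- **Lemma 2.1** (Janson–Mossel). Let `M` be a `q × q` row-stochastic real matrix and `v`
a probability row vector with `vM = v` and `v i > 0` for every `i`. Then for every vector
`b` with `b i > 0` for all `i`, one has `∑ i, v i / (M b) i ≤ ∑ i, v i / b i`, where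
`(M b) i = ∑ j, M i j * b j`. -/
theorem stationary_sum_inv_mulVec_le
    (q : ℕ) (M : Matrix (Fin q) (Fin q) ℝ)
    (hMnonneg : ∀ i j, 0 ≤ M i j)
    (hMrow : ∀ i, ∑ j, M i j = 1)
    (v : Fin q → ℝ)
    (hvpos : ∀ i, 0 < v i)
    (hvsum : ∑ i, v i = 1)
    (hstat : ∀ j, ∑ i, v i * M i j = v j)
    (b : Fin q → ℝ) (hb : ∀ i, 0 < b i) :
    ∑ i, v i / (∑ j, M i j * b j) ≤ ∑ i, v i / b i := by
  calc ∑ i, v i / (∑ j, M i j * b j)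
      ≤ ∑ i, v i * ∑ j, M i j * (b j)⁻¹ := by
        refine Finset.sum_le_sum fun i _ => ?_
        rw [div_eq_mul_inv]
        exact mul_le_mul_of_nonneg_left
          (inv_sum_mul_le_sum_mul_inv _ (fun j _ => hMnonneg i j) (hMrow i) fun j _ => hb j)
          (hvpos i).le
    _ = ∑ j, (∑ i, v i * M i j) * (b j)⁻¹ := by
        simp_rw [Finset.mul_sum, Finset.sum_mul, mul_assoc]
        exact Finset.sum_comm
    _ = ∑ i, v i / b i := by
        simp_rw [hstat, div_eq_mul_inv]
end

section
/- Contraction of discrepancy under the Markov operator: suppose α ≥ 0 is such that (Mb)ᵀT(Mb) ≤ α² · bᵀTb for all b ∈ ℝ^q with v·b = 0. Let Ω be a finite set, μ : Ω → (0,∞) a weight function, and f = (f_1,…,f_q) a vector of densities f_i : Ω → (0,∞) with ∑_{x∈Ω} f_i(x)μ(x) = 1 for each i. Define g_i(x) = ∑_{j=1}^q M_{i,j} f_j(x). Then g = (g_1,…,g_q) is again a vector of densities with respect to μ, and D(g) ≤ α² · D(f). -/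
/-- The discrepancy `D^μ(f)` of a vector of densities `f = (f_1, …, f_q)` with respect to a
reference weight `μ` on a finite set `Ω`:
`D^μ(f) = ∑_x (f(x)ᵀ T f(x)) · (∑_k v_k / f_k(x)) · μ(x)`. -/
noncomputable def disc {q : ℕ} (v : Fin q → ℝ) (T : Matrix (Fin q) (Fin q) ℝ)
    {Ω : Type} [Fintype Ω] (μ : Ω → ℝ) (f : Fin q → Ω → ℝ) : ℝ :=
  ∑ x, (∑ i, ∑ j, f i x * T i j * f j x) * (∑ k, v k / f k x) * μ x

/-- The expansion of the quadratic form of a symmetric `T` along the direction `1`. -/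
theorem quadForm_add_const_expand {ι : Type*} [Fintype ι] {T : Matrix ι ι ℝ}
    (hTsymm : ∀ i j, T i j = T j i) (b : ι → ℝ) (c : ℝ) :
    ∑ i, ∑ j, (b i + c) * T i j * (b j + c) =
      ∑ i, ∑ j, b i * T i j * b j + 2 * c * ∑ i, ∑ j, b i * T i j + c ^ 2 * ∑ i, ∑ j, T i j := by
  have hswap : ∑ i, ∑ j, T i j * b j = ∑ i, ∑ j, b i * T i j := by
    rw [Finset.sum_comm]
    refine Finset.sum_congr rfl fun i _ => Finset.sum_congr rfl fun j _ => ?_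
    rw [hTsymm j i, mul_comm]
  have hsplit : ∑ i, ∑ j, (b i + c) * T i j * (b j + c) =
      ∑ i, ∑ j, b i * T i j * b j + c * ∑ i, ∑ j, b i * T i j + c * ∑ i, ∑ j, T i j * b j +
        c ^ 2 * ∑ i, ∑ j, T i j := by
    simp only [Finset.mul_sum, ← Finset.sum_add_distrib]
    refine Finset.sum_congr rfl fun i _ => Finset.sum_congr rfl fun j _ => ?_
    ring
  rw [hsplit, hswap]
  ring

/-- A positive semidefinite quadratic form vanishing on `1` is invariant under adding constants. -/
theorem quadForm_add_const {ι : Type*} [Fintype ι] {T : Matrix ι ι ℝ}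
    (hTsymm : ∀ i j, T i j = T j i)
    (hTpsd : ∀ b : ι → ℝ, 0 ≤ ∑ i, ∑ j, b i * T i j * b j)
    (hone : ∑ i, ∑ j, T i j = 0) (b : ι → ℝ) (c : ℝ) :
    ∑ i, ∑ j, (b i + c) * T i j * (b j + c) = ∑ i, ∑ j, b i * T i j * b j := by
  have hlin : ∑ i, ∑ j, b i * T i j = 0 := by
    by_contra hne
    set l := ∑ i, ∑ j, b i * T i j with hl
    set s := ∑ i, ∑ j, b i * T i j * b j with hs
    have h := hTpsd fun i => b i + -(s + 1) / (2 * l)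
    rw [quadForm_add_const_expand hTsymm, hone, ← hl, ← hs] at h
    have hval : 2 * (-(s + 1) / (2 * l)) * l = -(s + 1) := by field_simp
    linarith
  rw [quadForm_add_const_expand hTsymm, hone, hlin]
  ring

/-- Jensen's inequality for the reciprocal. -/
theorem inv_weighted_sum_le {ι : Type*} [Fintype ι] {w a : ι → ℝ}
    (hw : ∀ i, 0 ≤ w i) (hw1 : ∑ i, w i = 1) (ha : ∀ i, 0 < a i) (hpos : 0 < ∑ i, w i * a i) :
    (∑ i, w i * a i)⁻¹ ≤ ∑ i, w i / a i := by
  have h := Finset.sum_sq_le_sum_mul_sum_of_sq_le_mul Finset.univ (r := w)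
    (f := fun i => w i * a i) (g := fun i => w i / a i)
    (fun i _ => mul_nonneg (hw i) (ha i).le) (fun i _ => div_nonneg (hw i) (ha i).le)
    (fun i _ => le_of_eq (by have := (ha i).ne'; field_simp))
  rw [hw1, one_pow] at h
  exact (inv_le_iff_one_le_mul₀' hpos).2 h

/-- **Lemma 2.5** (Janson–Mossel). Contraction of the discrepancy under the Markov operator:
if `(Mb)ᵀ T (Mb) ≤ α² bᵀ T b` for all `b` with `v ⬝ b = 0`, and `g i x = ∑ j, M i j * f j x`,
then `g` is again a vector of densities with respect to `μ` and `D(g) ≤ α² · D(f)`. -/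
theorem disc_markov_contraction
    (q : ℕ) (hq : 1 ≤ q) (M : Matrix (Fin q) (Fin q) ℝ)
    (hMnonneg : ∀ i j, 0 ≤ M i j)
    (hMrow : ∀ i, ∑ j, M i j = 1)
    (v : Fin q → ℝ)
    (hvpos : ∀ i, 0 < v i)
    (hvsum : ∑ i, v i = 1)
    (hstat : ∀ j, ∑ i, v i * M i j = v j)
    (T : Matrix (Fin q) (Fin q) ℝ)
    (hTsymm : ∀ i j, T i j = T j i)
    (hTpsd : ∀ b : Fin q → ℝ, 0 ≤ ∑ i, ∑ j, b i * T i j * b j)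
    (hTconst : ∀ b : Fin q → ℝ, (∑ i, ∑ j, b i * T i j * b j) = 0 ↔ ∃ c : ℝ, ∀ i, b i = c)
    (α : ℝ) (hα : 0 ≤ α)
    (hcontract : ∀ b : Fin q → ℝ, (∑ i, v i * b i) = 0 →
      (∑ i, ∑ j, M.mulVec b i * T i j * M.mulVec b j)
        ≤ α ^ 2 * ∑ i, ∑ j, b i * T i j * b j)
    (Ω : Type) [Fintype Ω]
    (μ : Ω → ℝ) (hμ : ∀ x, 0 < μ x)
    (f : Fin q → Ω → ℝ)
    (hf : ∀ i x, 0 < f i x)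
    (hfdens : ∀ i, ∑ x, f i x * μ x = 1)
    (g : Fin q → Ω → ℝ)
    (hgdef : ∀ i x, g i x = ∑ j, M i j * f j x) :
    (∀ i x, 0 < g i x) ∧ (∀ i, ∑ x, g i x * μ x = 1) ∧
      disc v T μ g ≤ α ^ 2 * disc v T μ f := by
  have hgpos : ∀ i x, 0 < g i x := by
    intro i x
    rw [hgdef]
    obtain ⟨j, hj⟩ : ∃ j, M i j ≠ 0 := by
      by_contra! h
      simpa [h] using hMrow i
    exact Finset.sum_pos' (fun k _ => mul_nonneg (hMnonneg i k) (hf k x).le)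
      ⟨j, Finset.mem_univ j, mul_pos ((hMnonneg i j).lt_of_ne' hj) (hf j x)⟩
  refine ⟨hgpos, fun i => ?_, ?_⟩
  · simp only [hgdef, Finset.sum_mul]
    rw [Finset.sum_comm]
    simp only [mul_assoc, ← Finset.mul_sum, hfdens, mul_one, hMrow]
  · have hone : ∑ i, ∑ j, T i j = 0 := by
      simpa using (hTconst fun _ => 1).2 ⟨1, fun _ => rfl⟩
    have hform : ∀ x, ∑ i, ∑ j, g i x * T i j * g j x ≤
        α ^ 2 * ∑ i, ∑ j, f i x * T i j * f j x := by
      intro x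
      set c := ∑ i, v i * f i x with hc
      have hMb : ∀ i, M.mulVec (fun j => f j x + -c) i = g i x + -c := by
        intro i
        simp only [Matrix.mulVec, dotProduct, mul_add, Finset.sum_add_distrib, ← Finset.sum_mul,
          hMrow, hgdef, one_mul]
      have h := hcontract (fun j => f j x + -c) (by
        simp only [mul_add, Finset.sum_add_distrib, ← Finset.sum_mul, hvsum, ← hc]
        ring)
      simp only [hMb] at h
      rwa [quadForm_add_const hTsymm hTpsd hone, quadForm_add_const hTsymm hTpsd hone] at h
    have hrecip : ∀ x, ∑ k, v k / g k x ≤ ∑ k, v k / f k x := by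
      intro x
      calc ∑ k, v k / g k x ≤ ∑ k, v k * ∑ j, M k j / f j x := by
            refine Finset.sum_le_sum fun k _ => ?_
            have hk := hgpos k x
            rw [hgdef] at hk
            rw [div_eq_mul_inv, hgdef]
            exact mul_le_mul_of_nonneg_left
              (inv_weighted_sum_le (hMnonneg k) (hMrow k) (fun j => hf j x) hk) (hvpos k).le
        _ = ∑ j, v j / f j x := by
            simp only [Finset.mul_sum]
            rw [Finset.sum_comm]
            simp only [← mul_div_assoc, ← Finset.sum_div, hstat]
    unfold disc
    rw [Finset.mul_sum]
    refine Finset.sum_le_sum fun x _ => ?_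
    rw [← mul_assoc, ← mul_assoc]
    refine mul_le_mul_of_nonneg_right ?_ (hμ x).le
    exact mul_le_mul (hform x) (hrecip x)
      (Finset.sum_nonneg fun k _ => div_nonneg (hvpos k).le (hgpos k x).le)
      (mul_nonneg (sq_nonneg α) (hTpsd fun i => f i x))
end

section
/- There exists a constant C, depending only on q, v and T (and not on Ω, μ or f), such that for every finite set Ω, every weight function μ : Ω → (0,∞), every vector f = (f_1,…,f_q) of densities f_i : Ω → (0,∞) with ∑_{x∈Ω} f_i(x)μ(x) = 1 for each i, and all indices i, j, k ∈ {1,…,q}: |∑_{x∈Ω} (f_i(x) f_j(x) / f_k(x)) μ(x) − 1| ≤ C · D(f). -/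
open Matrix in
/-- A positive-semidefinite quadratic form which vanishes exactly on the constant vectors
controls the differences of coordinates. -/
theorem exists_sq_sub_le_mul_quadForm {ι : Type*} [Fintype ι] (T : Matrix ι ι ℝ)
    (hTsymm : ∀ i j, T i j = T j i)
    (hTpsd : ∀ b : ι → ℝ, 0 ≤ ∑ i, ∑ j, b i * T i j * b j)
    (hTconst : ∀ b : ι → ℝ, (∑ i, ∑ j, b i * T i j * b j) = 0 ↔ ∃ c : ℝ, ∀ i, b i = c)
    (k : ι) :
    ∃ K : ℝ, 0 ≤ K ∧ ∀ (b : ι → ℝ) (i : ι),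
      (b i - b k) ^ 2 ≤ K * ∑ i, ∑ j, b i * T i j * b j := by
  have hQ (b : ι → ℝ) : ∑ i, ∑ j, b i * T i j * b j = b ⬝ᵥ T *ᵥ b := by
    simp only [dotProduct, mulVec, Finset.mul_sum, mul_assoc]
  simp only [hQ] at hTpsd hTconst ⊢
  have hT : Tᵀ = T := Matrix.ext fun i j => hTsymm j i
  have hpsd : T.PosSemidef := by
    refine PosSemidef.of_dotProduct_mulVec_nonneg ?_ fun b => ?_
    · rw [IsHermitian, conjTranspose_eq_transpose_of_trivial, hT]
    · simpa using hTpsd b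
  have hker (t : ℝ) : T *ᵥ (fun _ => t) = 0 := by
    refine (hpsd.dotProduct_mulVec_zero_iff _).1 ?_
    simpa using (hTconst _).2 ⟨t, fun _ => rfl⟩
  have hshift (b : ι → ℝ) (t : ℝ) :
      (b - fun _ => t) ⬝ᵥ T *ᵥ (b - fun _ => t) = b ⬝ᵥ T *ᵥ b := by
    rw [mulVec_sub, hker, sub_zero, sub_dotProduct, dotProduct_mulVec (fun _ => t),
      ← mulVec_transpose, hT, hker, zero_dotProduct, sub_zero]
  have hcompact : IsCompact (Metric.sphere (0 : ι → ℝ) 1 ∩ {b | b k = 0}) :=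
    (isCompact_sphere _ _).inter_right
      (isClosed_eq (continuous_apply k) continuous_const)
  have hcont : Continuous fun b : ι → ℝ => b ⬝ᵥ T *ᵥ b := by
    simp only [← hQ]
    fun_prop
  obtain ⟨m, hm, hmin⟩ := hcompact.exists_forall_le' (a := 0) hcont.continuousOn (by
    rintro b ⟨hb, hbk⟩
    refine lt_of_le_of_ne (hTpsd b) fun h => ?_
    obtain ⟨c, hc⟩ := (hTconst b).1 h.symm
    have hb0 : b = 0 := funext fun i => by rw [hc i, ← hc k]; exact hbk
    simp [hb0] at hb)
  refine ⟨m⁻¹, by positivity, fun b i => ?_⟩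
  rw [← hshift b (b k)]
  set c : ι → ℝ := b - fun _ => b k with hc
  have hck : c k = 0 := by simp [hc]
  change c i ^ 2 ≤ _
  rw [inv_mul_eq_div, le_div_iff₀ hm]
  by_cases h0 : c = 0
  · simp [h0]
  have hpos : 0 < ‖c‖ := norm_pos_iff.2 h0
  have h1 := hmin (‖c‖⁻¹ • c) ⟨by simp [norm_smul, hpos.ne'], by simp [hck]⟩
  rw [mulVec_smul, smul_dotProduct, dotProduct_smul, smul_eq_mul, smul_eq_mul, ← mul_assoc,
    ← mul_inv, inv_mul_eq_div, le_div_iff₀ (by positivity)] at h1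
  have h2 : c i ^ 2 ≤ ‖c‖ ^ 2 := sq_le_sq.2 (by
    rw [abs_norm]
    exact norm_le_pi_norm c i)
  nlinarith

/-- **Lemma 2.6** (Janson–Mossel). There is a constant `C` depending only on `q`, `v` and `T`
such that for every finite `Ω`, every weight `μ`, every vector of densities `f` and all
indices `i, j, k`: `|∑_x (f_i(x) f_j(x) / f_k(x)) μ(x) − 1| ≤ C · D(f)`. -/
theorem abs_chi_integral_sub_one_le_disc
    (q : ℕ) (hq : 1 ≤ q) (M : Matrix (Fin q) (Fin q) ℝ)
    (hMnonneg : ∀ i j, 0 ≤ M i j)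
    (hMrow : ∀ i, ∑ j, M i j = 1)
    (v : Fin q → ℝ)
    (hvpos : ∀ i, 0 < v i)
    (hvsum : ∑ i, v i = 1)
    (hstat : ∀ j, ∑ i, v i * M i j = v j)
    (T : Matrix (Fin q) (Fin q) ℝ)
    (hTsymm : ∀ i j, T i j = T j i)
    (hTpsd : ∀ b : Fin q → ℝ, 0 ≤ ∑ i, ∑ j, b i * T i j * b j)
    (hTconst : ∀ b : Fin q → ℝ, (∑ i, ∑ j, b i * T i j * b j) = 0 ↔ ∃ c : ℝ, ∀ i, b i = c) :
    ∃ C : ℝ, ∀ (Ω : Type) [Fintype Ω],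
      ∀ (μ : Ω → ℝ), (∀ x, 0 < μ x) →
      ∀ (f : Fin q → Ω → ℝ), (∀ i x, 0 < f i x) →
      (∀ i, ∑ x, f i x * μ x = 1) →
      ∀ i j k : Fin q,
        |(∑ x, f i x * f j x / f k x * μ x) - 1| ≤ C * disc v T μ f := by
  choose K hK0 hK using exists_sq_sub_le_mul_quadForm T hTsymm hTpsd hTconst
  refine ⟨∑ k, K k / v k, fun Ω _ μ hμ f hf hsum i j k => ?_⟩
  have hexpand : (∑ x, f i x * f j x / f k x * μ x) - 1 =
      ∑ x, (f i x - f k x) * (f j x - f k x) / f k x * μ x := by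
    have h (x : Ω) : (f i x - f k x) * (f j x - f k x) / f k x * μ x =
        f i x * f j x / f k x * μ x - f i x * μ x - f j x * μ x + f k x * μ x := by
      have := (hf k x).ne'
      field_simp
      ring
    simp only [h, Finset.sum_add_distrib, Finset.sum_sub_distrib, hsum]
    ring
  rw [hexpand, disc, Finset.mul_sum]
  refine (Finset.abs_sum_le_sum_abs _ _).trans (Finset.sum_le_sum fun x _ => ?_)
  rw [abs_mul, abs_of_pos (hμ x), abs_div, abs_of_pos (hf k x), ← mul_assoc]
  refine mul_le_mul_of_nonneg_right ?_ (hμ x).le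
  set Q := ∑ i, ∑ j, f i x * T i j * f j x
  have hQ : 0 ≤ Q := hTpsd fun i => f i x
  have hprod : |(f i x - f k x) * (f j x - f k x)| ≤ K k * Q := by
    have hi : (f i x - f k x) ^ 2 ≤ K k * Q := hK k (fun i => f i x) i
    have hj : (f j x - f k x) ^ 2 ≤ K k * Q := hK k (fun i => f i x) j
    rw [abs_le]
    constructor <;>
      nlinarith [sq_nonneg ((f i x - f k x) - (f j x - f k x)),
        sq_nonneg ((f i x - f k x) + (f j x - f k x))]
  have hC : K k / v k ≤ ∑ k, K k / v k :=
    Finset.single_le_sum (f := fun k => K k / v k)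
      (fun l _ => div_nonneg (hK0 l) (hvpos l).le) (Finset.mem_univ k)
  have hV : v k / f k x ≤ ∑ k, v k / f k x :=
    Finset.single_le_sum (f := fun k => v k / f k x)
      (fun l _ => div_nonneg (hvpos l).le (hf l x).le) (Finset.mem_univ k)
  have hv := hvpos k
  have hfk := hf k x
  calc |(f i x - f k x) * (f j x - f k x)| / f k x ≤ K k * Q / f k x := by gcongr
    _ = K k / v k * (Q * (v k / f k x)) := by field_simp
    _ ≤ (∑ k, K k / v k) * (Q * ∑ k, v k / f k x) := by
      have := hK0 k
      gcongr
      exact (div_nonneg this hv.le).trans hC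
end

section
/- There exists a constant C, depending only on q, v and T (and not on Ω, μ or f), such that for every finite set Ω, every weight function μ : Ω → (0,∞), every vector f = (f_1,…,f_q) of densities f_i : Ω → (0,∞) with ∑_{x∈Ω} f_i(x)μ(x) = 1 for each i, and all indices i, j, k ∈ {1,…,q}: ∑_{x∈Ω} (|f_i(x) − f_j(x)|² / f_k(x)) μ(x) ≤ C · D(f). -/
/-- If the real linear functional `l` vanishes on the kernel of a matrix `A`, then `(l b) ^ 2` is
bounded by a multiple of the squared Euclidean norm of `A b`. -/
lemma exists_sq_le_mul_sum_mulVec_sq {m n : Type*} [Fintype m] [Fintype n]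
    (A : Matrix m n ℝ) (l : (n → ℝ) →ₗ[ℝ] ℝ) (hl : ∀ b, A.mulVec b = 0 → l b = 0) :
    ∃ K : ℝ, 0 ≤ K ∧ ∀ b, l b ^ 2 ≤ K * ∑ r, A.mulVec b r ^ 2 := by
  classical
  have hmem : l ∈ LinearMap.range A.mulVecLin.dualMap := by
    rw [LinearMap.range_dualMap_eq_dualAnnihilator_ker, Submodule.mem_dualAnnihilator]
    exact fun b hb => hl b (by simpa using hb)
  obtain ⟨g, hg⟩ := hmem
  refine ⟨∑ r, g (Pi.single r 1) ^ 2, Finset.sum_nonneg fun _ _ => sq_nonneg _, fun b => ?_⟩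
  have hb : l b = ∑ r, g (Pi.single r 1) * A.mulVec b r := by
    rw [← hg, LinearMap.dualMap_apply, Matrix.mulVecLin_apply, LinearMap.pi_apply_eq_sum_univ g]
    refine Finset.sum_congr rfl fun r _ => ?_
    rw [smul_eq_mul, mul_comm]
    congr 2
    ext s
    simp [Pi.single_apply, eq_comm]
  rw [hb]
  exact Finset.sum_mul_sq_le_sq_mul_sq _ _ _

open scoped MatrixOrder in
/-- A positive-semidefinite quadratic form whose kernel is the constant vectors dominates all
squared coordinate differences. -/
lemma exists_sub_sq_le_mul_quadratic {n : Type*} [Fintype n] (T : Matrix n n ℝ)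
    (hTsymm : ∀ i j, T i j = T j i)
    (hTpsd : ∀ b : n → ℝ, 0 ≤ ∑ i, ∑ j, b i * T i j * b j)
    (hTconst : ∀ b : n → ℝ, (∑ i, ∑ j, b i * T i j * b j) = 0 → ∃ c : ℝ, ∀ i, b i = c) :
    ∃ K : ℝ, 0 ≤ K ∧ ∀ (b : n → ℝ) (i j : n),
      (b i - b j) ^ 2 ≤ K * ∑ i, ∑ j, b i * T i j * b j := by
  classical
  have hquad (b : n → ℝ) : b ⬝ᵥ T.mulVec b = ∑ i, ∑ j, b i * T i j * b j := by
    simp [dotProduct, Matrix.mulVec, Finset.mul_sum, mul_assoc]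
  have hT : T.PosSemidef := by
    refine Matrix.PosSemidef.of_dotProduct_mulVec_nonneg ?_ fun b => ?_
    · ext i j
      simpa using hTsymm j i
    · simpa [hquad] using hTpsd b
  obtain ⟨A, hA⟩ := CStarAlgebra.nonneg_iff_eq_star_mul_self.mp hT.nonneg
  have hsum (b : n → ℝ) : ∑ r, A.mulVec b r ^ 2 = ∑ i, ∑ j, b i * T i j * b j := by
    rw [← hquad, hA, Matrix.star_eq_conjTranspose, ← Matrix.mulVec_mulVec, Matrix.dotProduct_mulVec,
      Matrix.conjTranspose_eq_transpose_of_trivial, Matrix.vecMul_transpose]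
    simp [dotProduct, sq]
  have hK (i j : n) : ∃ K : ℝ, 0 ≤ K ∧ ∀ b : n → ℝ,
      (b i - b j) ^ 2 ≤ K * ∑ i, ∑ j, b i * T i j * b j := by
    obtain ⟨K, hK0, hK⟩ := exists_sq_le_mul_sum_mulVec_sq A
      (LinearMap.proj (R := ℝ) (φ := fun _ : n => ℝ) i - LinearMap.proj j) fun b hb => by
        obtain ⟨c, hc⟩ := hTconst b (by rw [← hsum, hb]; simp)
        simp [hc]
    exact ⟨K, hK0, fun b => by simpa [hsum] using hK b⟩
  choose K hK0 hK using hK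
  refine ⟨∑ i, ∑ j, K i j,
    Finset.sum_nonneg fun i _ => Finset.sum_nonneg fun j _ => hK0 i j, fun b i j => ?_⟩
  refine (hK i j b).trans (mul_le_mul_of_nonneg_right ?_ (hTpsd b))
  calc K i j ≤ ∑ j, K i j :=
        Finset.single_le_sum (fun j _ => hK0 i j) (Finset.mem_univ j)
    _ ≤ ∑ i, ∑ j, K i j :=
        Finset.single_le_sum (f := fun i => ∑ j, K i j)
          (fun i _ => Finset.sum_nonneg fun j _ => hK0 i j) (Finset.mem_univ i)

/-- **(18) in Lemma 2.6** (Janson–Mossel). There is a constant `C` depending only on `q`, `v`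
and `T` such that for every finite `Ω`, every weight `μ`, every vector of densities `f` and
all indices `i, j, k`: `∑_x (|f_i(x) − f_j(x)|² / f_k(x)) μ(x) ≤ C · D(f)`. -/
theorem chi_square_diff_le_disc
    (q : ℕ) (hq : 1 ≤ q) (M : Matrix (Fin q) (Fin q) ℝ)
    (hMnonneg : ∀ i j, 0 ≤ M i j)
    (hMrow : ∀ i, ∑ j, M i j = 1)
    (v : Fin q → ℝ)
    (hvpos : ∀ i, 0 < v i)
    (hvsum : ∑ i, v i = 1)
    (hstat : ∀ j, ∑ i, v i * M i j = v j)
    (T : Matrix (Fin q) (Fin q) ℝ)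
    (hTsymm : ∀ i j, T i j = T j i)
    (hTpsd : ∀ b : Fin q → ℝ, 0 ≤ ∑ i, ∑ j, b i * T i j * b j)
    (hTconst : ∀ b : Fin q → ℝ, (∑ i, ∑ j, b i * T i j * b j) = 0 ↔ ∃ c : ℝ, ∀ i, b i = c) :
    ∃ C : ℝ, ∀ (Ω : Type) [Fintype Ω],
      ∀ (μ : Ω → ℝ), (∀ x, 0 < μ x) →
      ∀ (f : Fin q → Ω → ℝ), (∀ i x, 0 < f i x) →
      (∀ i, ∑ x, f i x * μ x = 1) →
      ∀ i j k : Fin q,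
        (∑ x, |f i x - f j x| ^ 2 / f k x * μ x) ≤ C * disc v T μ f := by
  obtain ⟨K, hK0, hK⟩ :=
    exists_sub_sq_le_mul_quadratic T hTsymm hTpsd fun b => (hTconst b).mp
  refine ⟨K * ∑ k, (v k)⁻¹, fun Ω _ μ hμ f hf _ i j k => ?_⟩
  rw [disc, Finset.mul_sum]
  refine Finset.sum_le_sum fun x _ => ?_
  have hinv : (v k)⁻¹ ≤ ∑ k, (v k)⁻¹ :=
    Finset.single_le_sum (f := fun k => (v k)⁻¹)
      (fun k _ => (inv_pos.mpr (hvpos k)).le) (Finset.mem_univ k)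
  have hquot (l : Fin q) : 0 ≤ v l / f l x := (div_pos (hvpos l) (hf l x)).le
  have hdiv : v k / f k x ≤ ∑ k, v k / f k x :=
    Finset.single_le_sum (f := fun k => v k / f k x) (fun l _ => hquot l) (Finset.mem_univ k)
  have hweight : (f k x)⁻¹ ≤ (∑ k, (v k)⁻¹) * ∑ k, v k / f k x := by
    calc (f k x)⁻¹ = (v k)⁻¹ * (v k / f k x) := by
          rw [div_eq_mul_inv, inv_mul_cancel_left₀ (hvpos k).ne']
      _ ≤ _ := mul_le_mul hinv hdiv (hquot k) ((inv_pos.mpr (hvpos k)).le.trans hinv)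
  have hquad := hK (fun i => f i x) i j
  calc |f i x - f j x| ^ 2 / f k x * μ x = (f i x - f j x) ^ 2 * (f k x)⁻¹ * μ x := by
        rw [sq_abs, div_eq_mul_inv]
    _ ≤ K * (∑ i, ∑ j, f i x * T i j * f j x) *
          ((∑ k, (v k)⁻¹) * ∑ k, v k / f k x) * μ x :=
        mul_le_mul_of_nonneg_right
          (mul_le_mul hquad hweight (inv_pos.mpr (hf k x)).le ((sq_nonneg _).trans hquad))
          (hμ x).le
    _ = _ := by ring
end

section
/- Near-additivity of the discrepancy under products: for every ε > 0 and every integer B ≥ 1 there exists δ > 0 (depending only on ε, B, q, v and T) with the following property. Let Ω_1,…,Ω_B be finite sets with weight functions μ_r : Ω_r → (0,∞), and for each r = 1,…,B let f^r = (f^r_1,…,f^r_q) be a vector of densities f^r_i : Ω_r → (0,∞) with ∑_{x∈Ω_r} f^r_i(x)μ_r(x) = 1 for each i, such that D(f^r) ≤ δ for every r. Define the product density vector g on Ω_1×…×Ω_B by g_i(x_1,…,x_B) = ∏_{r=1}^B f^r_i(x_r), with weight function μ(x_1,…,x_B) = ∏_{r=1}^B μ_r(x_r). Then D(g) ≤ (1+ε)(D(f^1)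 + … + D(f^B)). -/
/-- The second-order error of a finite product `∏ (1 + c r)` is dominated by that of `exp`. -/
theorem abs_prod_one_add_sub_one_sub_sum_le {ι : Type*} (s : Finset ι) (c : ι → ℝ) :
    |∏ r ∈ s, (1 + c r) - 1 - ∑ r ∈ s, c r|
      ≤ Real.exp (∑ r ∈ s, |c r|) - 1 - ∑ r ∈ s, |c r| := by
  classical
  induction s using Finset.induction_on with
  | empty => simp
  | insert a s ha ih =>
    rw [Finset.prod_insert ha, Finset.sum_insert ha, Finset.sum_insert ha, Real.exp_add]
    have hfirst : |∏ r ∈ s, (1 + c r) - 1| ≤ Real.exp (∑ r ∈ s, |c r|) - 1 := by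
      simpa [Real.norm_eq_abs] using Finset.norm_prod_one_add_sub_one_le s c
    have hmul : |c a * (∏ r ∈ s, (1 + c r) - 1)|
        ≤ |c a| * (Real.exp (∑ r ∈ s, |c r|) - 1) := by
      rw [abs_mul]
      exact mul_le_mul_of_nonneg_left hfirst (abs_nonneg _)
    have hexp : (|c a| + 1) * Real.exp (∑ r ∈ s, |c r|)
        ≤ Real.exp |c a| * Real.exp (∑ r ∈ s, |c r|) :=
      mul_le_mul_of_nonneg_right (Real.add_one_le_exp _) (Real.exp_pos _).le
    calc |(1 + c a) * ∏ r ∈ s, (1 + c r) - 1 - (c a + ∑ r ∈ s, c r)|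
        = |(∏ r ∈ s, (1 + c r) - 1 - ∑ r ∈ s, c r) + c a * (∏ r ∈ s, (1 + c r) - 1)| := by
          congr 1; ring
      _ ≤ _ := abs_add_le _ _
      _ ≤ _ := by linarith

/-- A quadratic form vanishing only on constant vectors is coercive on vectors with a fixed
coordinate equal to zero. -/
theorem exists_coercive_of_coord_eq_zero {q : ℕ} (T : Matrix (Fin q) (Fin q) ℝ)
    (hTpsd : ∀ b : Fin q → ℝ, 0 ≤ ∑ i, ∑ j, b i * T i j * b j)
    (hTconst : ∀ b : Fin q → ℝ, (∑ i, ∑ j, b i * T i j * b j) = 0 → ∃ c : ℝ, ∀ i, b i = c)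
    (k : Fin q) :
    ∃ c : ℝ, 0 < c ∧ ∀ b : Fin q → ℝ, b k = 0 →
      c * ∑ i, b i ^ 2 ≤ ∑ i, ∑ j, b i * T i j * b j := by
  let K : Set (Fin q → ℝ) := {b | b k = 0 ∧ ∑ i, b i ^ 2 = 1}
  have hclosed : IsClosed K :=
    (isClosed_eq (by fun_prop) (by fun_prop)).inter (isClosed_eq (by fun_prop) (by fun_prop))
  have hbdd : K ⊆ Metric.closedBall 0 1 := by
    rintro b ⟨-, hb⟩
    rw [mem_closedBall_zero_iff, pi_norm_le_iff_of_nonneg zero_le_one]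
    intro i
    rw [Real.norm_eq_abs, ← sq_le_one_iff_abs_le_one, ← hb]
    exact Finset.single_le_sum (f := fun i => b i ^ 2) (fun i _ => sq_nonneg _)
      (Finset.mem_univ i)
  have hcompact : IsCompact K := (isCompact_closedBall 0 1).of_isClosed_subset hclosed hbdd
  obtain ⟨c, hc, hmin⟩ := hcompact.exists_forall_le'
    (f := fun b : Fin q → ℝ => ∑ i, ∑ j, b i * T i j * b j) (a := 0)
    (by fun_prop) (by
      rintro b ⟨hbk, hb⟩
      refine lt_of_le_of_ne (hTpsd b) fun h => ?_
      obtain ⟨t, ht⟩ := hTconst b h.symm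
      have : ∀ i, b i = 0 := fun i => by rw [ht i, ← ht k, hbk]
      simp [this] at hb)
  refine ⟨c, hc, fun b hbk => ?_⟩
  rcases (Finset.sum_nonneg fun i _ => sq_nonneg (b i) :
    0 ≤ ∑ i, b i ^ 2).eq_or_lt with hs | hs
  · rw [← hs, mul_zero]
    exact hTpsd b
  · set s := ∑ i, b i ^ 2 with hsdef
    have hsq : (√s) ^ 2 = s := Real.sq_sqrt hs.le
    have hne : √s ≠ 0 := (Real.sqrt_pos.2 hs).ne'
    have h := hmin (fun i => b i / √s) ⟨by simp [hbk], by
      simp_rw [div_pow, hsq]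
      rw [← Finset.sum_div, ← hsdef, div_self hs.ne']⟩
    have hscale : ∑ i, ∑ j, b i / √s * T i j * (b j / √s)
        = (∑ i, ∑ j, b i * T i j * b j) / s := by
      simp_rw [Finset.sum_div]
      refine Finset.sum_congr rfl fun i _ => Finset.sum_congr rfl fun j _ => ?_
      rw [div_mul_eq_mul_div, div_mul_div_comm, ← sq, hsq]
    simp only [hscale] at h
    exact (le_div_iff₀ hs).1 h

/-- The moment `∑_x f_i f_j / f_k μ`, i.e. the second moment of the likelihood ratios
`f_i / f_k` and `f_j / f_k` under the density `f_k`. -/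
noncomputable def ratioMoment {q : ℕ} {Ω : Type} [Fintype Ω] (μ : Ω → ℝ) (f : Fin q → Ω → ℝ)
    (k i j : Fin q) : ℝ :=
  ∑ x, f i x * f j x / f k x * μ x

/-- The contribution of the weight `1 / f_k` to the discrepancy. -/
noncomputable def discAt {q : ℕ} (T : Matrix (Fin q) (Fin q) ℝ) {Ω : Type} [Fintype Ω]
    (μ : Ω → ℝ) (f : Fin q → Ω → ℝ) (k : Fin q) : ℝ :=
  ∑ i, ∑ j, T i j * ratioMoment μ f k i j

theorem disc_eq_sum_discAt {q : ℕ} (v : Fin q → ℝ) (T : Matrix (Fin q) (Fin q) ℝ)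
    {Ω : Type} [Fintype Ω] (μ : Ω → ℝ) (f : Fin q → Ω → ℝ) :
    disc v T μ f = ∑ k, v k * discAt T μ f k := by
  have h : ∀ k, v k * discAt T μ f k
      = ∑ x, (∑ i, ∑ j, f i x * T i j * f j x) * (v k / f k x) * μ x := by
    intro k
    simp only [discAt, ratioMoment, Finset.mul_sum, Finset.sum_mul]
    symm
    rw [Finset.sum_comm]
    refine Finset.sum_congr rfl fun i _ => ?_
    rw [Finset.sum_comm]
    refine Finset.sum_congr rfl fun j _ => Finset.sum_congr rfl fun x _ => ?_
    ring
  simp_rw [h]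
  rw [Finset.sum_comm]
  refine Finset.sum_congr rfl fun x _ => ?_
  rw [Finset.mul_sum, Finset.sum_mul]

theorem ratioMoment_pi {q B : ℕ} {Ω : Fin B → Type} [∀ r, Fintype (Ω r)]
    (μ : ∀ r, Ω r → ℝ) (f : ∀ r, Fin q → Ω r → ℝ) (k i j : Fin q) :
    ratioMoment (fun x : ∀ r, Ω r => ∏ r, μ r (x r))
        (fun i (x : ∀ r, Ω r) => ∏ r, f r i (x r)) k i j
      = ∏ r, ratioMoment (μ r) (f r) k i j := by
  simp only [ratioMoment, Fintype.prod_sum, Finset.prod_mul_distrib, Finset.prod_div_distrib]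

section Density

variable {q : ℕ} {Ω : Type} [Fintype Ω] {μ : Ω → ℝ} {f : Fin q → Ω → ℝ}

theorem sum_ratio_sub_one_mul (hf : ∀ i x, 0 < f i x) (hsum : ∀ i, ∑ x, f i x * μ x = 1)
    (k i j : Fin q) :
    ∑ x, (f i x / f k x - 1) * (f j x / f k x - 1) * (f k x * μ x)
      = ratioMoment μ f k i j - 1 := by
  have h : ∀ x, (f i x / f k x - 1) * (f j x / f k x - 1) * (f k x * μ x)
      = f i x * f j x / f k x * μ x - f i x * μ x - f j x * μ x + f k x * μ x := by
    intro x
    have := (hf k x).ne'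
    field_simp
    ring
  simp_rw [h, Finset.sum_add_distrib, Finset.sum_sub_distrib, hsum, ratioMoment]
  ring

theorem discAt_eq_sum_sub_one {T : Matrix (Fin q) (Fin q) ℝ} (hT : ∑ i, ∑ j, T i j = 0)
    (k : Fin q) :
    discAt T μ f k = ∑ i, ∑ j, T i j * (ratioMoment μ f k i j - 1) := by
  simp_rw [mul_sub, mul_one, Finset.sum_sub_distrib, hT, sub_zero, discAt]

theorem discAt_eq_sum_quadratic {T : Matrix (Fin q) (Fin q) ℝ} (hT : ∑ i, ∑ j, T i j = 0)
    (hf : ∀ i x, 0 < f i x) (hsum : ∀ i, ∑ x, f i x * μ x = 1) (k : Fin q) :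
    discAt T μ f k = ∑ x, (∑ i, ∑ j, (f i x / f k x - 1) * T i j * (f j x / f k x - 1))
      * (f k x * μ x) := by
  rw [discAt_eq_sum_sub_one hT]
  simp_rw [← sum_ratio_sub_one_mul hf hsum, Finset.mul_sum, Finset.sum_mul]
  symm
  rw [Finset.sum_comm]
  refine Finset.sum_congr rfl fun i _ => ?_
  rw [Finset.sum_comm]
  refine Finset.sum_congr rfl fun j _ => Finset.sum_congr rfl fun x _ => ?_
  ring

theorem discAt_nonneg {T : Matrix (Fin q) (Fin q) ℝ} (hT : ∑ i, ∑ j, T i j = 0)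
    (hTpsd : ∀ b : Fin q → ℝ, 0 ≤ ∑ i, ∑ j, b i * T i j * b j)
    (hμ : ∀ x, 0 < μ x) (hf : ∀ i x, 0 < f i x) (hsum : ∀ i, ∑ x, f i x * μ x = 1)
    (k : Fin q) : 0 ≤ discAt T μ f k := by
  rw [discAt_eq_sum_quadratic hT hf hsum]
  exact Finset.sum_nonneg fun x _ =>
    mul_nonneg (hTpsd fun i => f i x / f k x - 1) (mul_pos (hf k x) (hμ x)).le

theorem mul_abs_ratioMoment_sub_one_le {T : Matrix (Fin q) (Fin q) ℝ}
    (hT : ∑ i, ∑ j, T i j = 0) {c : ℝ} {k : Fin q} (hc : 0 < c)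
    (hcoer : ∀ b : Fin q → ℝ, b k = 0 → c * ∑ i, b i ^ 2 ≤ ∑ i, ∑ j, b i * T i j * b j)
    (hμ : ∀ x, 0 < μ x) (hf : ∀ i x, 0 < f i x) (hsum : ∀ i, ∑ x, f i x * μ x = 1)
    (i j : Fin q) :
    c * |ratioMoment μ f k i j - 1| ≤ discAt T μ f k := by
  rw [discAt_eq_sum_quadratic hT hf hsum, ← sum_ratio_sub_one_mul hf hsum]
  refine (mul_le_mul_of_nonneg_left (Finset.abs_sum_le_sum_abs _ _) hc.le).trans ?_
  rw [Finset.mul_sum]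
  refine Finset.sum_le_sum fun x _ => ?_
  have hpos : 0 < f k x * μ x := mul_pos (hf k x) (hμ x)
  rw [abs_mul, abs_of_pos hpos, ← mul_assoc]
  refine mul_le_mul_of_nonneg_right ?_ hpos.le
  refine le_trans (mul_le_mul_of_nonneg_left ?_ hc.le)
    (hcoer (fun i => f i x / f k x - 1) (by simp [(hf k x).ne']))
  have hle : ∀ l, (f l x / f k x - 1) ^ 2 ≤ ∑ i, (f i x / f k x - 1) ^ 2 := fun l =>
    Finset.single_le_sum (f := fun i => (f i x / f k x - 1) ^ 2) (fun i _ => sq_nonneg _)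
      (Finset.mem_univ l)
  rw [abs_mul]
  nlinarith [hle i, hle j, sq_nonneg (|f i x / f k x - 1| - |f j x / f k x - 1|),
    sq_abs (f i x / f k x - 1), sq_abs (f j x / f k x - 1)]

end Density

/-- Near-additivity for a single weight `1 / f_k`. -/
theorem exists_discAt_pi_le {q : ℕ} {T : Matrix (Fin q) (Fin q) ℝ}
    (hTpsd : ∀ b : Fin q → ℝ, 0 ≤ ∑ i, ∑ j, b i * T i j * b j)
    (hTconst : ∀ b : Fin q → ℝ, (∑ i, ∑ j, b i * T i j * b j) = 0 → ∃ c : ℝ, ∀ i, b i = c)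
    (hT : ∑ i, ∑ j, T i j = 0) {ε : ℝ} (hε : 0 < ε) {B : ℕ} (hB : 1 ≤ B) (k : Fin q) :
    ∃ δ : ℝ, 0 < δ ∧
      ∀ (Ω : Fin B → Type) [∀ r, Fintype (Ω r)],
      ∀ (μ : ∀ r, Ω r → ℝ), (∀ r x, 0 < μ r x) →
      ∀ (f : ∀ r, Fin q → Ω r → ℝ),
        (∀ r i x, 0 < f r i x) →
        (∀ r i, ∑ x, f r i x * μ r x = 1) →
        (∀ r, discAt T (μ r) (f r) k ≤ δ) →
        discAt T (fun x : ∀ r, Ω r => ∏ r, μ r (x r))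
            (fun i (x : ∀ r, Ω r) => ∏ r, f r i (x r)) k
          ≤ (1 + ε) * ∑ r, discAt T (μ r) (f r) k := by
  obtain ⟨c, hc, hcoer⟩ := exists_coercive_of_coord_eq_zero T hTpsd hTconst k
  have hB' : (0 : ℝ) < B := by exact_mod_cast hB
  set N : ℝ := (∑ i, ∑ j, |T i j|) + 1 with hN
  have hTabs : 0 ≤ ∑ i, ∑ j, |T i j| :=
    Finset.sum_nonneg fun i _ => Finset.sum_nonneg fun j _ => abs_nonneg _
  have hNpos : 0 < N := by linarith
  refine ⟨min (c / B) (ε * c ^ 2 / (N * B)), by positivity, ?_⟩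
  intro Ω _ μ hμ f hf hsum hδ
  set s : ℝ := ∑ r, discAt T (μ r) (f r) k with hs
  have hs0 : 0 ≤ s :=
    Finset.sum_nonneg fun r _ => discAt_nonneg hT hTpsd (hμ r) (hf r) (hsum r) k
  have hsle : s ≤ B * min (c / B) (ε * c ^ 2 / (N * B)) := by
    have := Finset.sum_le_sum fun r (_ : r ∈ Finset.univ) => hδ r
    simpa using this
  have hsc : s ≤ c := by
    refine hsle.trans ((mul_le_mul_of_nonneg_left (min_le_left _ _) hB'.le).trans_eq ?_)
    field_simp
  have hsε : N * s ≤ ε * c ^ 2 := by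
    have h := hsle.trans (mul_le_mul_of_nonneg_left (min_le_right _ _) hB'.le)
    have h' := mul_le_mul_of_nonneg_left h hNpos.le
    refine h'.trans_eq ?_
    field_simp
  have hmoment : ∀ i j, ∑ r, |ratioMoment (μ r) (f r) k i j - 1| ≤ s / c := by
    intro i j
    rw [le_div_iff₀' hc, Finset.mul_sum]
    exact Finset.sum_le_sum fun r _ =>
      mul_abs_ratioMoment_sub_one_le hT hc hcoer (hμ r) (hf r) (hsum r) i j
  have herr : ∀ i j, |∏ r, ratioMoment (μ r) (f r) k i j - 1
      - ∑ r, (ratioMoment (μ r) (f r) k i j - 1)| ≤ (s / c) ^ 2 := by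
    intro i j
    have h0 : 0 ≤ ∑ r, |ratioMoment (μ r) (f r) k i j - 1| :=
      Finset.sum_nonneg fun r _ => abs_nonneg _
    have h1 := abs_prod_one_add_sub_one_sub_sum_le Finset.univ
      fun r => ratioMoment (μ r) (f r) k i j - 1
    simp only [add_sub_cancel] at h1
    have h2 := Real.abs_exp_sub_one_sub_id_le
      (x := ∑ r, |ratioMoment (μ r) (f r) k i j - 1|)
      (by rw [abs_of_nonneg h0]; exact (hmoment i j).trans ((div_le_one hc).2 hsc))
    exact (h1.trans (le_abs_self _)).trans
      (h2.trans (pow_le_pow_left₀ h0 (hmoment i j) 2))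
  have hs_eq : s = ∑ i, ∑ j, T i j * ∑ r, (ratioMoment (μ r) (f r) k i j - 1) := by
    simp_rw [hs, discAt_eq_sum_sub_one hT, Finset.mul_sum]
    rw [Finset.sum_comm]
    exact Finset.sum_congr rfl fun i _ => Finset.sum_comm
  have hdiff : discAt T (fun x : ∀ r, Ω r => ∏ r, μ r (x r))
      (fun i (x : ∀ r, Ω r) => ∏ r, f r i (x r)) k - s ≤ ∑ i, ∑ j, |T i j| * (s / c) ^ 2 := by
    rw [discAt_eq_sum_sub_one hT, hs_eq, ← Finset.sum_sub_distrib]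
    refine Finset.sum_le_sum fun i _ => ?_
    rw [← Finset.sum_sub_distrib]
    refine Finset.sum_le_sum fun j _ => ?_
    rw [ratioMoment_pi, ← mul_sub, ← hs_eq]
    refine (le_abs_self _).trans ?_
    rw [abs_mul]
    exact mul_le_mul_of_nonneg_left (herr i j) (abs_nonneg _)
  have hfinal : ∑ i, ∑ j, |T i j| * (s / c) ^ 2 ≤ ε * s := by
    simp_rw [← Finset.sum_mul]
    calc (∑ i, ∑ j, |T i j|) * (s / c) ^ 2 ≤ N * (s / c) ^ 2 :=
          mul_le_mul_of_nonneg_right (by linarith) (sq_nonneg _)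
      _ = N * s * s / c ^ 2 := by ring
      _ ≤ ε * c ^ 2 * s / c ^ 2 := by gcongr
      _ = ε * s := by field_simp
  linarith

/-- **Lemma 2.7, first part** (Janson–Mossel). Near-additivity of the discrepancy under
products: for every `ε > 0` and every integer `B ≥ 1` there exists `δ > 0` (depending only on
`ε, B, q, v, T`) such that whenever `f^1, …, f^B` are density vectors on finite weighted sets
`(Ω_r, μ_r)` with `D(f^r) ≤ δ` for every `r`, the component-wise product density vector `g`
on `Ω_1 × ⋯ × Ω_B` satisfies `D(g) ≤ (1+ε)(D(f^1) + ⋯ + D(f^B))`. -/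
theorem disc_prod_near_additive
    (q : ℕ) (hq : 1 ≤ q) (M : Matrix (Fin q) (Fin q) ℝ)
    (hMnonneg : ∀ i j, 0 ≤ M i j)
    (hMrow : ∀ i, ∑ j, M i j = 1)
    (v : Fin q → ℝ)
    (hvpos : ∀ i, 0 < v i)
    (hvsum : ∑ i, v i = 1)
    (hstat : ∀ j, ∑ i, v i * M i j = v j)
    (T : Matrix (Fin q) (Fin q) ℝ)
    (hTsymm : ∀ i j, T i j = T j i)
    (hTpsd : ∀ b : Fin q → ℝ, 0 ≤ ∑ i, ∑ j, b i * T i j * b j)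
    (hTconst : ∀ b : Fin q → ℝ, (∑ i, ∑ j, b i * T i j * b j) = 0 ↔ ∃ c : ℝ, ∀ i, b i = c)
    (ε : ℝ) (hε : 0 < ε) (B : ℕ) (hB : 1 ≤ B) :
    ∃ δ : ℝ, 0 < δ ∧
      ∀ (Ω : Fin B → Type) [∀ r, Fintype (Ω r)],
      ∀ (μ : ∀ r, Ω r → ℝ), (∀ r x, 0 < μ r x) →
      ∀ (f : ∀ r, Fin q → Ω r → ℝ),
        (∀ r i x, 0 < f r i x) →
        (∀ r i, ∑ x, f r i x * μ r x = 1) →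
        (∀ r, disc v T (μ r) (f r) ≤ δ) →
        disc v T (fun x : ∀ r, Ω r => ∏ r, μ r (x r))
            (fun i (x : ∀ r, Ω r) => ∏ r, f r i (x r))
          ≤ (1 + ε) * ∑ r, disc v T (μ r) (f r) := by
  have hT : ∑ i, ∑ j, T i j = 0 := by
    simpa using (hTconst fun _ => 1).2 ⟨1, fun _ => rfl⟩
  choose d hd hprod using fun k => exists_discAt_pi_le hTpsd (fun b => (hTconst b).1) hT hε hB k
  have : Nonempty (Fin q) := ⟨⟨0, hq⟩⟩
  obtain ⟨k₀, hk₀⟩ := Finite.exists_min fun k => v k * d k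
  refine ⟨v k₀ * d k₀, mul_pos (hvpos _) (hd _), ?_⟩
  intro Ω _ μ hμ f hf hsum hδ
  have hsmall : ∀ k r, discAt T (μ r) (f r) k ≤ d k := by
    intro k r
    have hterm : v k * discAt T (μ r) (f r) k ≤ disc v T (μ r) (f r) := by
      rw [disc_eq_sum_discAt]
      exact Finset.single_le_sum (f := fun k => v k * discAt T (μ r) (f r) k)
        (fun l _ => mul_nonneg (hvpos l).le
          (discAt_nonneg hT hTpsd (hμ r) (hf r) (hsum r) l)) (Finset.mem_univ k)
    exact le_of_mul_le_mul_left ((hterm.trans (hδ r)).trans (hk₀ k)) (hvpos k)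
  simp_rw [disc_eq_sum_discAt]
  rw [Finset.sum_comm, Finset.mul_sum]
  refine Finset.sum_le_sum fun k _ => ?_
  rw [← Finset.mul_sum, mul_left_comm]
  exact mul_le_mul_of_nonneg_left (hprod k Ω μ hμ f hf hsum (hsmall k)) (hvpos k).le
end

section
/- Near-multiplicativity under tensor powers: for every ε > 0 and every integer B ≥ 1 there exists δ > 0 (depending only on ε, B, q, v and T) such that for every finite set Ω with weight function μ : Ω → (0,∞) and every vector f = (f_1,…,f_q) of densities f_i : Ω → (0,∞) with ∑_{x∈Ω} f_i(x)μ(x) = 1 for each i and D(f) ≤ δ, the B-fold tensor power f^{⊗B}, defined on Ω^B by f^{⊗B}_i(x_1,…,x_B) = ∏_{r=1}^B f_i(x_r) with weight μ^{⊗B}(x_1,…,x_B) = ∏_{r=1}^B μ(x_r), satisfies D(f^{⊗B}) ≤ (1+ε)·B·D(f). -/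
/-- The correlation `∑ₓ fᵢ fⱼ / fₖ · μ`; it is multiplicative under tensor products. -/
noncomputable def densityGram {q : ℕ} {Ω : Type} [Fintype Ω] (μ : Ω → ℝ) (f : Fin q → Ω → ℝ)
    (k i j : Fin q) : ℝ :=
  ∑ x, f i x * f j x / f k x * μ x

theorem disc_eq_sum_densityGram {q : ℕ} (v : Fin q → ℝ) (T : Matrix (Fin q) (Fin q) ℝ)
    {Ω : Type} [Fintype Ω] (μ : Ω → ℝ) (f : Fin q → Ω → ℝ) :
    disc v T μ f = ∑ k, ∑ i, ∑ j, v k * T i j * densityGram μ f k i j := by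
  have h : ∀ x, (∑ i, ∑ j, f i x * T i j * f j x) * (∑ k, v k / f k x) * μ x =
      ∑ k, ∑ i, ∑ j, v k * T i j * (f i x * f j x / f k x * μ x) := by
    intro x
    rw [Finset.mul_sum, Finset.sum_mul]
    refine Finset.sum_congr rfl fun k _ => ?_
    rw [Finset.sum_mul, Finset.sum_mul]
    refine Finset.sum_congr rfl fun i _ => ?_
    rw [Finset.sum_mul, Finset.sum_mul]
    exact Finset.sum_congr rfl fun j _ => by ring
  rw [disc, Finset.sum_congr rfl fun x _ => h x, Finset.sum_comm]
  refine Finset.sum_congr rfl fun k _ => ?_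
  rw [Finset.sum_comm]
  refine Finset.sum_congr rfl fun i _ => ?_
  rw [Finset.sum_comm]
  exact Finset.sum_congr rfl fun j _ => (Finset.mul_sum _ _ _).symm

theorem densityGram_tensor_power {q : ℕ} {Ω : Type} [Fintype Ω] (μ : Ω → ℝ)
    (f : Fin q → Ω → ℝ) (B : ℕ) (k i j : Fin q) :
    densityGram (fun x : Fin B → Ω => ∏ r, μ (x r))
      (fun i (x : Fin B → Ω) => ∏ r, f i (x r)) k i j = densityGram μ f k i j ^ B := by
  simp only [densityGram, Fintype.sum_pow, Finset.prod_mul_distrib, Finset.prod_div_distrib]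

theorem densityGram_sub_one {q : ℕ} {Ω : Type} [Fintype Ω] {μ : Ω → ℝ} {f : Fin q → Ω → ℝ}
    (hf : ∀ i x, 0 < f i x) (hsum : ∀ i, ∑ x, f i x * μ x = 1) (k i j : Fin q) :
    densityGram μ f k i j - 1 = ∑ x, (f i x - f k x) * (f j x - f k x) / f k x * μ x := by
  have h : ∀ x, (f i x - f k x) * (f j x - f k x) / f k x * μ x =
      f i x * f j x / f k x * μ x - f i x * μ x - f j x * μ x + f k x * μ x := by
    intro x
    have := (hf k x).ne'
    field_simp
    ring
  simp only [h, Finset.sum_add_distrib, Finset.sum_sub_distrib, hsum, densityGram]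
  ring

/-- A positive-semidefinite form vanishing only on constant vectors controls the squared
differences of coordinates. -/
theorem exists_coercive_of_eq_zero_iff_const {q : ℕ} (T : Matrix (Fin q) (Fin q) ℝ)
    (hTsymm : ∀ i j, T i j = T j i)
    (hTpsd : ∀ b : Fin q → ℝ, 0 ≤ ∑ i, ∑ j, b i * T i j * b j)
    (hTconst : ∀ b : Fin q → ℝ,
      (∑ i, ∑ j, b i * T i j * b j) = 0 ↔ ∃ c : ℝ, ∀ i, b i = c) :
    ∃ c : ℝ, 0 < c ∧ ∀ (b : Fin q → ℝ) (k : Fin q),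
      c * ∑ i, (b i - b k) ^ 2 ≤ ∑ i, ∑ j, b i * T i j * b j := by
  let Q : (Fin q → ℝ) → ℝ := fun b => ∑ i, ∑ j, b i * T i j * b j
  have hcont : Continuous Q := by fun_prop
  have hscale : ∀ (t : ℝ) b, Q (fun i => t * b i) = t ^ 2 * Q b := by
    intro t b
    simp only [Q, Finset.mul_sum]
    exact Finset.sum_congr rfl fun i _ => Finset.sum_congr rfl fun j _ => by ring
  have hshift : ∀ (b : Fin q → ℝ) (t : ℝ), Q (fun i => b i - t) = Q b := by
    intro b t
    let L : ℝ := ∑ i, ∑ j, b i * T i j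
    have hsum0 : ∑ i, ∑ j, T i j = 0 := by
      have := (hTconst fun _ => 1).2 ⟨1, fun _ => rfl⟩
      simpa using this
    have hexp : ∀ s : ℝ, Q (fun i => b i - s) = Q b - 2 * s * L := by
      intro s
      have h2 : ∑ i, ∑ j, T i j * b j = L := by
        rw [Finset.sum_comm]
        exact Finset.sum_congr rfl fun i _ => Finset.sum_congr rfl fun j _ => by
          rw [hTsymm, mul_comm]
      have h3 : ∀ i j, (b i - s) * T i j * (b j - s) =
          b i * T i j * b j - s * (b i * T i j) - s * (T i j * b j) + s ^ 2 * T i j := by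
        intro i j; ring
      have h1 : ∑ i, b i * ∑ j, T i j = L := by simp only [L, Finset.mul_sum]
      simp only [Q, h3, Finset.sum_add_distrib, Finset.sum_sub_distrib, ← Finset.mul_sum, h1, h2,
        hsum0]
      ring
    have hL : L = 0 := by
      by_contra hL
      have h1 := hTpsd (fun i => b i - (Q b + 1) / (2 * L))
      have h4 := hexp ((Q b + 1) / (2 * L))
      have h5 : 2 * ((Q b + 1) / (2 * L)) * L = Q b + 1 := by field_simp
      simp only [Q] at h1 h4 h5
      linarith
    rw [hexp, hL]
    ring
  suffices h : ∃ c : ℝ, 0 < c ∧ ∀ (b : Fin q → ℝ), (∃ k, b k = 0) →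
      c * ∑ i, b i ^ 2 ≤ Q b by
    obtain ⟨c, hc, h⟩ := h
    refine ⟨c, hc, fun b k => ?_⟩
    have := h (fun i => b i - b k) ⟨k, sub_self _⟩
    rwa [hshift] at this
  let S : Set (Fin q → ℝ) := {b | ∑ i, b i ^ 2 = 1} ∩ ⋃ k, {b | b k = 0}
  have hSclosed : IsClosed S := by
    refine IsClosed.inter (isClosed_eq (by fun_prop) continuous_const) ?_
    exact isClosed_iUnion_of_finite fun k => isClosed_eq (by fun_prop) continuous_const
  have hScompact : IsCompact S := by
    have hbox : IsCompact (Set.univ.pi fun _ : Fin q => Set.Icc (-1 : ℝ) 1) :=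
      isCompact_univ_pi fun _ => isCompact_Icc
    refine hbox.of_isClosed_subset hSclosed fun b hb i _ => ?_
    have h1 : b i ^ 2 ≤ 1 := by
      rw [← hb.1]
      exact Finset.single_le_sum (f := fun i => b i ^ 2) (fun j _ => sq_nonneg (b j))
        (Finset.mem_univ i)
    exact abs_le.1 ((sq_le_one_iff_abs_le_one _).1 h1)
  have hSpos : ∃ c : ℝ, 0 < c ∧ ∀ b ∈ S, c ≤ Q b := by
    rcases S.eq_empty_or_nonempty with hS | hS
    · exact ⟨1, one_pos, by simp [hS]⟩
    · obtain ⟨b, hb, hmin⟩ := hScompact.exists_isMinOn hS hcont.continuousOn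
      refine ⟨Q b, lt_of_le_of_ne (hTpsd b) fun h0 => ?_, fun b' hb' => hmin hb'⟩
      obtain ⟨c, hc⟩ := (hTconst b).1 h0.symm
      obtain ⟨k, hk⟩ := Set.mem_iUnion.1 hb.2
      have hc0 : c = 0 := (hc k).symm.trans hk
      have := hb.1
      simp [hc, hc0] at this
  obtain ⟨c, hc, hS⟩ := hSpos
  refine ⟨c, hc, fun b ⟨k, hk⟩ => ?_⟩
  rcases (Finset.sum_nonneg fun i (_ : i ∈ Finset.univ) => sq_nonneg (b i)).eq_or_lt with h | h
  · rw [← h, mul_zero]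
    exact hTpsd b
  · set s := ∑ i, b i ^ 2
    have hs : (√s)⁻¹ ^ 2 = s⁻¹ := by rw [inv_pow, Real.sq_sqrt h.le]
    have hmem : (fun i => (√s)⁻¹ * b i) ∈ S := by
      refine ⟨?_, Set.mem_iUnion.2 ⟨k, by simp [hk]⟩⟩
      simp only [Set.mem_ofPred_eq, mul_pow, ← Finset.mul_sum, hs]
      exact inv_mul_cancel₀ h.ne'
    have h1 := hS _ hmem
    rw [hscale, hs, inv_mul_eq_div, le_div_iff₀ h] at h1
    exact h1

theorem exists_abs_densityGram_sub_one_le {q : ℕ} (v : Fin q → ℝ) (hvpos : ∀ i, 0 < v i)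
    (T : Matrix (Fin q) (Fin q) ℝ)
    (hTsymm : ∀ i j, T i j = T j i)
    (hTpsd : ∀ b : Fin q → ℝ, 0 ≤ ∑ i, ∑ j, b i * T i j * b j)
    (hTconst : ∀ b : Fin q → ℝ,
      (∑ i, ∑ j, b i * T i j * b j) = 0 ↔ ∃ c : ℝ, ∀ i, b i = c) :
    ∃ K : ℝ, 0 < K ∧ ∀ (Ω : Type) [Fintype Ω] (μ : Ω → ℝ), (∀ x, 0 < μ x) →
      ∀ (f : Fin q → Ω → ℝ), (∀ i x, 0 < f i x) → (∀ i, ∑ x, f i x * μ x = 1) →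
      ∀ k i j, v k * |densityGram μ f k i j - 1| ≤ K * disc v T μ f := by
  obtain ⟨c, hc, hco⟩ := exists_coercive_of_eq_zero_iff_const T hTsymm hTpsd hTconst
  refine ⟨c⁻¹, inv_pos.2 hc, ?_⟩
  intro Ω _ μ hμ f hf hsum k i j
  rw [densityGram_sub_one hf hsum, disc, inv_mul_eq_div, le_div_iff₀ hc]
  refine (mul_le_mul_of_nonneg_right (mul_le_mul_of_nonneg_left
    (Finset.abs_sum_le_sum_abs _ _) (hvpos k).le) hc.le).trans ?_
  rw [Finset.mul_sum, Finset.sum_mul]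
  refine Finset.sum_le_sum fun x _ => ?_
  have hfk := hf k x
  have hQ := hco (fun l => f l x) k
  have hv : v k / f k x ≤ ∑ l, v l / f l x :=
    Finset.single_le_sum (f := fun l => v l / f l x)
      (fun l _ => (div_pos (hvpos l) (hf l x)).le) (Finset.mem_univ k)
  have hsq : ∀ l, (f l x - f k x) ^ 2 ≤ ∑ l, (f l x - f k x) ^ 2 := fun l =>
    Finset.single_le_sum (f := fun l => (f l x - f k x) ^ 2)
      (fun l _ => sq_nonneg _) (Finset.mem_univ l)
  have hab : |(f i x - f k x) * (f j x - f k x)| ≤ ∑ l, (f l x - f k x) ^ 2 := by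
    have h1 := hsq i
    have h2 := hsq j
    rw [abs_le]
    constructor <;>
      nlinarith [sq_nonneg ((f i x - f k x) + (f j x - f k x)),
        sq_nonneg ((f i x - f k x) - (f j x - f k x))]
  rw [abs_mul, abs_div, abs_of_pos hfk, abs_of_pos (hμ x)]
  calc v k * (|(f i x - f k x) * (f j x - f k x)| / f k x * μ x) * c
      = (c * |(f i x - f k x) * (f j x - f k x)|) * (v k / f k x) * μ x := by ring
    _ ≤ (∑ i, ∑ j, f i x * T i j * f j x) * (∑ l, v l / f l x) * μ x := by
        refine mul_le_mul_of_nonneg_right ?_ (hμ x).le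
        exact mul_le_mul ((mul_le_mul_of_nonneg_left hab hc.le).trans hQ) hv
          (div_pos (hvpos k) hfk).le (hTpsd _)

theorem exists_abs_pow_sub_linear_le (B : ℕ) {η : ℝ} (hη : 0 < η) :
    ∃ ρ : ℝ, 0 < ρ ∧ ∀ y : ℝ, |y - 1| < ρ → |y ^ B - 1 - B * (y - 1)| ≤ η * |y - 1| := by
  have h : HasDerivAt (fun y : ℝ => y ^ B) B 1 := by simpa using hasDerivAt_pow B (1 : ℝ)
  have h1 := (hasDerivAt_iff_isLittleO.1 h).def hη
  obtain ⟨ρ, hρ, h2⟩ := Metric.eventually_nhds_iff.1 h1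
  refine ⟨ρ, hρ, fun y hy => ?_⟩
  have := h2 (y := y) (by rwa [Real.dist_eq])
  simpa [mul_comm] using this

/-- **Lemma 2.7, second part** (Janson–Mossel). Near-multiplicativity under tensor powers:
for every `ε > 0` and every integer `B ≥ 1` there exists `δ > 0` (depending only on
`ε, B, q, v, T`) such that every density vector `f` with `D(f) ≤ δ` satisfies
`D(f^{⊗B}) ≤ (1+ε) · B · D(f)`. -/
theorem disc_tensor_power_near_multiplicative
    (q : ℕ) (hq : 1 ≤ q) (M : Matrix (Fin q) (Fin q) ℝ)
    (hMnonneg : ∀ i j, 0 ≤ M i j)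
    (hMrow : ∀ i, ∑ j, M i j = 1)
    (v : Fin q → ℝ)
    (hvpos : ∀ i, 0 < v i)
    (hvsum : ∑ i, v i = 1)
    (hstat : ∀ j, ∑ i, v i * M i j = v j)
    (T : Matrix (Fin q) (Fin q) ℝ)
    (hTsymm : ∀ i j, T i j = T j i)
    (hTpsd : ∀ b : Fin q → ℝ, 0 ≤ ∑ i, ∑ j, b i * T i j * b j)
    (hTconst : ∀ b : Fin q → ℝ, (∑ i, ∑ j, b i * T i j * b j) = 0 ↔ ∃ c : ℝ, ∀ i, b i = c)
    (ε : ℝ) (hε : 0 < ε) (B : ℕ) (hB : 1 ≤ B) :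
    ∃ δ : ℝ, 0 < δ ∧
      ∀ (Ω : Type) [Fintype Ω],
      ∀ (μ : Ω → ℝ), (∀ x, 0 < μ x) →
      ∀ (f : Fin q → Ω → ℝ),
        (∀ i x, 0 < f i x) →
        (∀ i, ∑ x, f i x * μ x = 1) →
        disc v T μ f ≤ δ →
        disc v T (fun x : Fin B → Ω => ∏ r, μ (x r))
            (fun i (x : Fin B → Ω) => ∏ r, f i (x r))
          ≤ (1 + ε) * B * disc v T μ f := by
  obtain ⟨K, hK, hG⟩ := exists_abs_densityGram_sub_one_le v hvpos T hTsymm hTpsd hTconst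
  have : Nonempty (Fin q) := ⟨⟨0, hq⟩⟩
  obtain ⟨k₀, hk₀⟩ := Finite.exists_min v
  have hm := hvpos k₀
  set A : ℝ := ∑ _k : Fin q, ∑ i, ∑ j, |T i j| * K with hA
  have hA0 : 0 ≤ A := by positivity
  have hB0 : (0 : ℝ) < B := by exact_mod_cast hB
  set η : ℝ := ε * B / (A + 1) with hη
  have hηpos : 0 < η := by positivity
  have hηA : η * A ≤ ε * B := by
    rw [hη, div_mul_eq_mul_div, div_le_iff₀ (by positivity)]
    nlinarith [mul_pos hε hB0]
  obtain ⟨ρ, hρ, hpow⟩ := exists_abs_pow_sub_linear_le B hηpos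
  refine ⟨ρ * v k₀ / (2 * K), by positivity, ?_⟩
  intro Ω _ μ hμ f hf hsum hD
  have hT0 : ∑ i, ∑ j, T i j = 0 := by
    simpa using (hTconst fun _ => 1).2 ⟨1, fun _ => rfl⟩
  have hD0 : 0 ≤ disc v T μ f := by
    have := hG Ω μ hμ f hf hsum k₀ k₀ k₀
    exact nonneg_of_mul_nonneg_right ((mul_nonneg hm.le (abs_nonneg _)).trans this) hK
  have hone : ∑ k, ∑ i, ∑ j, v k * T i j = 0 := by
    simp only [← Finset.mul_sum, hT0, mul_zero, Finset.sum_const_zero]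
  have hsplit : disc v T (fun x : Fin B → Ω => ∏ r, μ (x r))
        (fun i (x : Fin B → Ω) => ∏ r, f i (x r)) =
      B * disc v T μ f + ∑ k, ∑ i, ∑ j, v k * T i j *
        (densityGram μ f k i j ^ B - 1 - B * (densityGram μ f k i j - 1)) := by
    have h : ∀ k i j, v k * T i j *
        (densityGram μ f k i j ^ B - 1 - B * (densityGram μ f k i j - 1)) =
        v k * T i j * densityGram μ f k i j ^ B - v k * T i j
          - B * (v k * T i j * densityGram μ f k i j) + B * (v k * T i j) := by
      intro k i j; ring
    simp only [disc_eq_sum_densityGram, densityGram_tensor_power, h, Finset.sum_add_distrib,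
      Finset.sum_sub_distrib, ← Finset.mul_sum (a := (B : ℝ)), hone]
    ring
  have hrem : ∑ k, ∑ i, ∑ j, v k * T i j *
      (densityGram μ f k i j ^ B - 1 - B * (densityGram μ f k i j - 1)) ≤
      η * A * disc v T μ f := by
    simp only [hA, Finset.mul_sum, Finset.sum_mul]
    refine Finset.sum_le_sum fun k _ => Finset.sum_le_sum fun i _ =>
      Finset.sum_le_sum fun j _ => ?_
    have hGk := hG Ω μ hμ f hf hsum k i j
    have hsmall : |densityGram μ f k i j - 1| < ρ := by
      have h1 : v k₀ * |densityGram μ f k i j - 1| ≤ K * (ρ * v k₀ / (2 * K)) :=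
        (mul_le_mul_of_nonneg_right (hk₀ k) (abs_nonneg _)).trans
          (hGk.trans (mul_le_mul_of_nonneg_left hD hK.le))
      have h2 : K * (ρ * v k₀ / (2 * K)) = v k₀ * (ρ / 2) := by field_simp
      rw [h2] at h1
      linarith [le_of_mul_le_mul_left h1 hm]
    have hR := hpow _ hsmall
    set R := densityGram μ f k i j ^ B - 1 - B * (densityGram μ f k i j - 1)
    calc v k * T i j * R ≤ |v k * T i j * R| := le_abs_self _
      _ = |T i j| * v k * |R| := by rw [abs_mul, abs_mul, abs_of_pos (hvpos k)]; ring
      _ ≤ |T i j| * v k * (η * |densityGram μ f k i j - 1|) :=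
          mul_le_mul_of_nonneg_left hR (mul_nonneg (abs_nonneg _) (hvpos k).le)
      _ = |T i j| * η * (v k * |densityGram μ f k i j - 1|) := by ring
      _ ≤ |T i j| * η * (K * disc v T μ f) :=
          mul_le_mul_of_nonneg_left hGk (mul_nonneg (abs_nonneg _) hηpos.le)
      _ = η * (|T i j| * K) * disc v T μ f := by ring
  rw [hsplit]
  nlinarith [mul_le_mul_of_nonneg_right hηA hD0]
end

section
/- Total variation is controlled by the square root of the discrepancy: there exists a constant C, depending only on q, v and T, such that for every finite set Ω, every weight function μ : Ω → (0,∞), every vector f = (f_1,…,f_q) of densities f_i : Ω → (0,∞) with ∑_{x∈Ω} f_i(x)μ(x) = 1 for each i, and all i, j ∈ {1,…,q}: ∑_{x∈Ω} |f_i(x) − f_j(x)| μ(x) ≤ C·√(D(f)). In particular the total variation distance between the probability measures ν_i(x) = f_i(x)μ(x) and ν_j(x) = f_j(x)μ(x) is at most (C/2)·√(D(f)). -/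
/-- A linear functional vanishing on the null vectors of a symmetric positive-semidefinite form is
bounded by that form. -/
theorem exists_sq_le_mul_quadratic_form {ι : Type*} [Fintype ι] (T : Matrix ι ι ℝ)
    (hTsymm : ∀ i j, T i j = T j i)
    (hTpsd : ∀ b : ι → ℝ, 0 ≤ ∑ i, ∑ j, b i * T i j * b j)
    (φ : Module.Dual ℝ (ι → ℝ))
    (hφ : ∀ b : ι → ℝ, ∑ i, ∑ j, b i * T i j * b j = 0 → φ b = 0) :
    ∃ K : ℝ, 0 < K ∧ ∀ b : ι → ℝ, φ b ^ 2 ≤ K * ∑ i, ∑ j, b i * T i j * b j := by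
  classical
  have hrange : φ ∈ LinearMap.range T.mulVecLin.dualMap := by
    rw [LinearMap.range_dualMap_eq_dualAnnihilator_ker, Submodule.mem_dualAnnihilator]
    intro b hb
    rw [LinearMap.mem_ker, Matrix.mulVecLin_apply] at hb
    refine hφ b (Finset.sum_eq_zero fun i _ => ?_)
    have hi : ∑ j, T i j * b j = 0 := congrFun hb i
    simp_rw [mul_assoc, ← Finset.mul_sum, hi, mul_zero]
  obtain ⟨ψ, rfl⟩ := hrange
  set w : ι → ℝ := fun i => ψ (Pi.single i 1)
  have hψ (b : ι → ℝ) : T.mulVecLin.dualMap ψ b = ∑ i, ∑ j, w i * T i j * b j := by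
    rw [LinearMap.dualMap_apply, LinearMap.pi_apply_eq_sum_univ ψ]
    refine Finset.sum_congr rfl fun i _ => ?_
    have hsingle : (fun j => if i = j then (1 : ℝ) else 0) = Pi.single i 1 := by
      ext j
      simp [Pi.single_apply, eq_comm]
    simp only [hsingle, Matrix.mulVecLin_apply, Matrix.mulVec, dotProduct, smul_eq_mul, w,
      Finset.sum_mul]
    exact Finset.sum_congr rfl fun j _ => by ring
  have hK := hTpsd w
  refine ⟨(∑ i, ∑ j, w i * T i j * w j) + 1, by linarith, fun b => ?_⟩
  have hcross : ∑ i, ∑ j, b i * T i j * w j = ∑ i, ∑ j, w i * T i j * b j := by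
    rw [Finset.sum_comm]
    refine Finset.sum_congr rfl fun i _ => Finset.sum_congr rfl fun j _ => ?_
    rw [hTsymm j i]
    ring
  rw [hψ]
  have hexpand (t : ℝ) : ∑ i, ∑ j, (b i - t * w i) * T i j * (b j - t * w j) =
      (∑ i, ∑ j, b i * T i j * b j) - t * (∑ i, ∑ j, b i * T i j * w j)
        - t * (∑ i, ∑ j, w i * T i j * b j) + t ^ 2 * ∑ i, ∑ j, w i * T i j * w j := by
    simp only [Finset.mul_sum, ← Finset.sum_sub_distrib, ← Finset.sum_add_distrib]
    exact Finset.sum_congr rfl fun i _ => Finset.sum_congr rfl fun j _ => by ring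
  have hdisc (t : ℝ) := (hTpsd fun i => b i - t * w i).trans_eq (hexpand t)
  rw [hcross] at hdisc
  generalize ∑ i, ∑ j, w i * T i j * w j = K at *
  generalize ∑ i, ∑ j, w i * T i j * b j = p at *
  generalize hQ : ∑ i, ∑ j, b i * T i j * b j = Q at *
  have hQ0 : 0 ≤ Q := hQ ▸ hTpsd b
  have hle := discrim_le_zero (a := K) (b := -2 * p) (c := Q) fun t => by linarith [hdisc t]
  rw [discrim] at hle
  linarith

/-- A weighted `L¹` norm is bounded by the `χ²`-type sum against a probability density. -/
theorem sum_abs_mul_le_sqrt_sum_sq_div {Ω : Type*} [Fintype Ω] (μ g h : Ω → ℝ)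
    (hμ : ∀ x, 0 < μ x) (hg : ∀ x, 0 < g x) (hgsum : ∑ x, g x * μ x = 1) :
    ∑ x, |h x| * μ x ≤ √(∑ x, h x ^ 2 / g x * μ x) := by
  apply Real.le_sqrt_of_sq_le
  have hcs := Finset.sum_sq_le_sum_mul_sum_of_sq_le_mul Finset.univ
    (r := fun x => |h x| * μ x) (f := fun x => h x ^ 2 / g x * μ x) (g := fun x => g x * μ x)
    (fun x _ => mul_nonneg (div_nonneg (sq_nonneg _) (hg x).le) (hμ x).le)
    (fun x _ => (mul_pos (hg x) (hμ x)).le)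
    (fun x _ => le_of_eq <| by
      have := (hg x).ne'
      rw [mul_pow, sq_abs]
      field_simp)
  rwa [hgsum, mul_one] at hcs

/-- **Lemma 2.8** (Janson–Mossel). Total variation is controlled by the square root of the
discrepancy: there is a constant `C` depending only on `q`, `v`, `T` such that for every
density vector `f` and all `i, j`: `∑_x |f_i(x) − f_j(x)| μ(x) ≤ C √(D(f))`; in particular
the total variation distance between the probability measures `ν_i = f_i μ` and `ν_j = f_j μ`
is at most `(C/2) √(D(f))`. -/
theorem total_variation_le_sqrt_disc
    (q : ℕ) (hq : 1 ≤ q) (M : Matrix (Fin q) (Fin q) ℝ)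
    (hMnonneg : ∀ i j, 0 ≤ M i j)
    (hMrow : ∀ i, ∑ j, M i j = 1)
    (v : Fin q → ℝ)
    (hvpos : ∀ i, 0 < v i)
    (hvsum : ∑ i, v i = 1)
    (hstat : ∀ j, ∑ i, v i * M i j = v j)
    (T : Matrix (Fin q) (Fin q) ℝ)
    (hTsymm : ∀ i j, T i j = T j i)
    (hTpsd : ∀ b : Fin q → ℝ, 0 ≤ ∑ i, ∑ j, b i * T i j * b j)
    (hTconst : ∀ b : Fin q → ℝ, (∑ i, ∑ j, b i * T i j * b j) = 0 ↔ ∃ c : ℝ, ∀ i, b i = c) :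
    ∃ C : ℝ, ∀ (Ω : Type) [Fintype Ω],
      ∀ (μ : Ω → ℝ), (∀ x, 0 < μ x) →
      ∀ (f : Fin q → Ω → ℝ), (∀ i x, 0 < f i x) →
      (∀ i, ∑ x, f i x * μ x = 1) →
      ∀ i j : Fin q,
        (∑ x, |f i x - f j x| * μ x) ≤ C * Real.sqrt (disc v T μ f) ∧
        (1 / 2) * (∑ x, |f i x * μ x - f j x * μ x|)
          ≤ (C / 2) * Real.sqrt (disc v T μ f) := by
  have hbound (i j : Fin q) : ∃ K : ℝ, 0 < K ∧ ∀ b : Fin q → ℝ,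
      (b i - b j) ^ 2 ≤ K * ∑ k, ∑ l, b k * T k l * b l :=
    exists_sq_le_mul_quadratic_form T hTsymm hTpsd
      (LinearMap.proj (R := ℝ) (φ := fun _ : Fin q => ℝ) i - LinearMap.proj j) fun b hb => by
        obtain ⟨c, hc⟩ := (hTconst b).1 hb
        simp [hc]
  choose K hKpos hK using hbound
  refine ⟨√(∑ i, ∑ j, K i j / v i), fun Ω _ μ hμ f hf hfsum i j => ?_⟩
  have hratio_nonneg (i j : Fin q) : 0 ≤ K i j / v i := (div_pos (hKpos i j) (hvpos i)).le
  have hC : K i j / v i ≤ ∑ i, ∑ j, K i j / v i :=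
    (Finset.single_le_sum (fun l _ => hratio_nonneg i l) (Finset.mem_univ j)).trans
      (Finset.single_le_sum (f := fun k => ∑ l, K k l / v k)
        (fun k _ => Finset.sum_nonneg fun l _ => hratio_nonneg k l) (Finset.mem_univ i))
  have hmain : ∑ x, |f i x - f j x| * μ x ≤
      √(∑ i, ∑ j, K i j / v i) * √(disc v T μ f) := by
    rw [← Real.sqrt_mul ((hratio_nonneg i j).trans hC)]
    refine (sum_abs_mul_le_sqrt_sum_sq_div μ (f i) (fun x => f i x - f j x) hμ (hf i)
      (hfsum i)).trans (Real.sqrt_le_sqrt ?_)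
    rw [disc, Finset.mul_sum]
    refine Finset.sum_le_sum fun x _ => ?_
    rw [← mul_assoc]
    refine mul_le_mul_of_nonneg_right ?_ (hμ x).le
    have hQ := hTpsd fun k => f k x
    have hterm : v i / f i x ≤ ∑ k, v k / f k x :=
      Finset.single_le_sum (f := fun k => v k / f k x)
        (fun k _ => (div_pos (hvpos k) (hf k x)).le) (Finset.mem_univ i)
    have hvi := hvpos i
    have hfi := hf i x
    calc (f i x - f j x) ^ 2 / f i x
        ≤ (K i j * ∑ k, ∑ l, f k x * T k l * f l x) / f i x := by
          have := hK i j fun k => f k x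
          gcongr
      _ = K i j / v i * ((∑ k, ∑ l, f k x * T k l * f l x) * (v i / f i x)) := by
          field_simp
      _ ≤ _ := by
          gcongr
          exact (hratio_nonneg i j).trans hC
  refine ⟨hmain, ?_⟩
  have habs : ∑ x, |f i x * μ x - f j x * μ x| = ∑ x, |f i x - f j x| * μ x :=
    Finset.sum_congr rfl fun x _ => by rw [← sub_mul, abs_mul, abs_of_pos (hμ x)]
  rw [habs]
  linarith
end

section
/- Heavy mixing with a fixed measure makes the discrepancy small: let μ be a probability mass function on {1,…,q} with μ(x) > 0 for all x. For every δ > 0 there exists ε* < 1 such that for every ε with ε* < ε ≤ 1 and every vector ν' = (ν'_1,…,ν'_q) of probability mass functions on {1,…,q}, the density vector f given by f_i(x) = ((1−ε)ν'_i(x) + ε μ(x))/μ(x) (densities with respect to the reference weight μ of the mixed distributions ν_i = (1−ε)ν'_i + εμ) satisfies D(f) ≤ δ. -/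
/-- A quadratic form that vanishes on the constant vector `1` is small near that vector. -/
theorem quadForm_le_of_abs_sub_one_le {ι : Type*} [Fintype ι] (T : Matrix ι ι ℝ)
    (hT : ∑ i, ∑ j, T i j = 0) {b : ι → ℝ} {r K : ℝ} (hr : 0 ≤ r)
    (hb : ∀ i, |b i - 1| ≤ r) (hbK : ∀ i, |b i| ≤ K) :
    ∑ i, ∑ j, b i * T i j * b j ≤ r * (K + 1) * ∑ i, ∑ j, |T i j| := by
  have key : ∀ i j, b i * T i j * b j ≤ T i j + r * (K + 1) * |T i j| := by
    intro i j
    have h1 : |b i * b j - 1| ≤ r * (K + 1) := by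
      calc |b i * b j - 1| = |(b i - 1) * b j + (b j - 1)| := by ring_nf
        _ ≤ |(b i - 1) * b j| + |b j - 1| := abs_add_le _ _
        _ = |b i - 1| * |b j| + |b j - 1| := by rw [abs_mul]
        _ ≤ r * K + r := by gcongr <;> first | exact hb _ | exact hbK _
        _ = r * (K + 1) := by ring
    have h2 : T i j * (b i * b j - 1) ≤ |T i j| * (r * (K + 1)) :=
      (le_abs_self _).trans (by rw [abs_mul]; gcongr)
    linarith
  calc ∑ i, ∑ j, b i * T i j * b j
      ≤ ∑ i, ∑ j, (T i j + r * (K + 1) * |T i j|) :=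
        Finset.sum_le_sum fun i _ => Finset.sum_le_sum fun j _ => key i j
    _ = r * (K + 1) * ∑ i, ∑ j, |T i j| := by
        simp only [Finset.sum_add_distrib, ← Finset.mul_sum, hT, zero_add]

/-- **Lemma 2.9(i)** (Janson–Mossel). Heavy mixing with a fixed nondegenerate measure `μ`
makes the discrepancy small: for every `δ > 0` there is `ε* < 1` such that for every
`ε* < ε ≤ 1` and every vector `ν'` of probability mass functions on `{1,…,q}`, the densities
(w.r.t. `μ`) of the mixtures `ν_i = (1−ε)ν'_i + εμ` have discrepancy at most `δ`. -/
theorem disc_le_of_heavy_mixing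
    (q : ℕ) (hq : 1 ≤ q) (M : Matrix (Fin q) (Fin q) ℝ)
    (hMnonneg : ∀ i j, 0 ≤ M i j)
    (hMrow : ∀ i, ∑ j, M i j = 1)
    (v : Fin q → ℝ)
    (hvpos : ∀ i, 0 < v i)
    (hvsum : ∑ i, v i = 1)
    (hstat : ∀ j, ∑ i, v i * M i j = v j)
    (T : Matrix (Fin q) (Fin q) ℝ)
    (hTsymm : ∀ i j, T i j = T j i)
    (hTpsd : ∀ b : Fin q → ℝ, 0 ≤ ∑ i, ∑ j, b i * T i j * b j)
    (hTconst : ∀ b : Fin q → ℝ, (∑ i, ∑ j, b i * T i j * b j) = 0 ↔ ∃ c : ℝ, ∀ i, b i = c)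
    (μ : Fin q → ℝ) (hμpos : ∀ x, 0 < μ x) (hμsum : ∑ x, μ x = 1)
    (δ : ℝ) (hδ : 0 < δ) :
    ∃ εstar : ℝ, εstar < 1 ∧
      ∀ ε : ℝ, εstar < ε → ε ≤ 1 →
      ∀ ν' : Fin q → Fin q → ℝ,
        (∀ i x, 0 ≤ ν' i x) → (∀ i, ∑ x, ν' i x = 1) →
        disc v T μ (fun i x => ((1 - ε) * ν' i x + ε * μ x) / μ x) ≤ δ := by
  have hT0 : ∑ i, ∑ j, T i j = 0 := by
    simpa using (hTconst fun _ => 1).2 ⟨1, fun _ => rfl⟩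
  set S := ∑ i, ∑ j, |T i j|
  have hS0 : 0 ≤ S := Finset.sum_nonneg fun i _ => Finset.sum_nonneg fun j _ => abs_nonneg _
  set K := 1 + ∑ x, 1 / μ x
  have hinv : ∀ x, 0 ≤ 1 / μ x := fun x => (one_div_pos.2 (hμpos x)).le
  have hK1 : 1 ≤ K := le_add_of_nonneg_right (Finset.sum_nonneg fun x _ => hinv x)
  have hμK : ∀ x, 1 / μ x ≤ K := fun x =>
    (Finset.single_le_sum (f := fun x => 1 / μ x) (fun y _ => hinv y)
      (Finset.mem_univ x)).trans (by linarith)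
  set C := K * (K + 1) * S * 2 with hC
  have hC0 : 0 ≤ C := by positivity
  refine ⟨max (1 / 2) (1 - δ / (C + 1)), max_lt (by norm_num) ?_, ?_⟩
  · have : 0 < δ / (C + 1) := by positivity
    linarith
  intro ε hε hε1 ν' hν0 hν1
  have hε2 : 1 / 2 < ε := (le_max_left _ _).trans_lt hε
  have ht : (1 - ε) * C ≤ δ := by
    have h : 1 - ε ≤ δ / (C + 1) := by linarith [(le_max_right _ _).trans_lt hε]
    rw [le_div_iff₀ (by positivity)] at h
    linarith
  have hdens : ∀ i x, ((1 - ε) * ν' i x + ε * μ x) / μ x = (1 - ε) * (ν' i x / μ x) + ε := by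
    intro i x
    have := (hμpos x).ne'
    field_simp
  have hg0 : ∀ i x, 0 ≤ ν' i x / μ x := fun i x => div_nonneg (hν0 i x) (hμpos x).le
  have hgK : ∀ i x, ν' i x / μ x ≤ K := by
    intro i x
    have h : ν' i x ≤ 1 :=
      (Finset.single_le_sum (fun y _ => hν0 i y) (Finset.mem_univ x)).trans (hν1 i).le
    exact (div_le_div_of_nonneg_right h (hμpos x).le).trans (hμK x)
  have hε0 : 0 ≤ 1 - ε := by linarith
  unfold disc
  simp only [hdens]
  calc ∑ x, (∑ i, ∑ j, ((1 - ε) * (ν' i x / μ x) + ε) * T i j *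
          ((1 - ε) * (ν' j x / μ x) + ε)) *
          (∑ k, v k / ((1 - ε) * (ν' k x / μ x) + ε)) * μ x
      ≤ ∑ x, (1 - ε) * C * μ x := by
        refine Finset.sum_le_sum fun x _ => mul_le_mul_of_nonneg_right ?_ (hμpos x).le
        have hQ := quadForm_le_of_abs_sub_one_le T hT0
          (b := fun i => (1 - ε) * (ν' i x / μ x) + ε) (r := (1 - ε) * K) (K := K)
          (by positivity)
          (fun i => by
            have h : (1 - ε) * (ν' i x / μ x) + ε - 1 = (1 - ε) * (ν' i x / μ x - 1) := by ring
            rw [h, abs_mul, abs_of_nonneg hε0]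
            refine mul_le_mul_of_nonneg_left (abs_le.2 ⟨?_, ?_⟩) hε0 <;>
              linarith [hg0 i x, hgK i x])
          (fun i => by
            have h1 := mul_nonneg hε0 (hg0 i x)
            have h2 := mul_le_mul_of_nonneg_left (hgK i x) hε0
            have h3 := mul_le_mul_of_nonneg_left hK1 (show 0 ≤ ε by linarith)
            exact abs_le.2 ⟨by linarith, by linarith⟩)
        have hV : ∑ k, v k / ((1 - ε) * (ν' k x / μ x) + ε) ≤ 2 := by
          calc ∑ k, v k / ((1 - ε) * (ν' k x / μ x) + ε) ≤ ∑ k, v k * 2 := by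
                refine Finset.sum_le_sum fun k _ => ?_
                have h1 := mul_nonneg hε0 (hg0 k x)
                rw [div_le_iff₀ (by linarith)]
                nlinarith [hvpos k]
            _ = 2 := by rw [← Finset.sum_mul, hvsum, one_mul]
        have hV0 : 0 ≤ ∑ k, v k / ((1 - ε) * (ν' k x / μ x) + ε) :=
          Finset.sum_nonneg fun k _ => div_nonneg (hvpos k).le
            (by linarith [mul_nonneg hε0 (hg0 k x)])
        calc _ ≤ (1 - ε) * K * (K + 1) * S * 2 :=
              mul_le_mul hQ hV hV0 (by positivity)
          _ = (1 - ε) * C := by rw [hC]; ring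
    _ = (1 - ε) * C := by rw [← Finset.mul_sum, hμsum, mul_one]
    _ ≤ δ := ht
end

section
/- Heavy erasure makes the discrepancy small: let ν = (ν_1,…,ν_q) be probability mass functions on {1,…,q} with ν_i(j) > 0 for all i, j. For 0 < ε < 1 define probability mass functions ν^ε_i on {1,…,q+1} by ν^ε_i(j) = (1−ε)ν_i(j) for j ≤ q and ν^ε_i(q+1) = ε, and the reference weight μ^ε(j) = (1−ε)·(1/q)·∑_{i=1}^q ν_i(j) for j ≤ q, μ^ε(q+1) = ε. Then for every δ > 0 there exists ε* < 1 such that for all ε with ε* < ε < 1, the density vector f^ε given by f^ε_i(x) = ν^ε_i(x)/μ^ε(x) on Ω = {1,…,q+1} satisfies D(f^ε) ≤ δ. -/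
/-- The erasure-perturbed mass functions: `ν^ε_i(j) = (1−ε)ν_i(j)` for `j ≤ q` and
`ν^ε_i(q+1) = ε`. -/
noncomputable def nuEps {q : ℕ} (ν : Fin q → Fin q → ℝ) (ε : ℝ) (i : Fin q)
    (x : Fin (q + 1)) : ℝ :=
  if h : (x : ℕ) < q then (1 - ε) * ν i ⟨x, h⟩ else ε

/-- The reference weight for the erasure perturbation:
`μ^ε(j) = (1−ε)·(1/q)·∑_i ν_i(j)` for `j ≤ q` and `μ^ε(q+1) = ε`. -/
noncomputable def muEps {q : ℕ} (ν : Fin q → Fin q → ℝ) (ε : ℝ) (x : Fin (q + 1)) : ℝ :=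
  if h : (x : ℕ) < q then (1 - ε) * (1 / (q : ℝ)) * ∑ i, ν i ⟨x, h⟩ else ε

/-- For `0 < ε < 1` the discrepancy of the erasure-perturbed densities is `1 - ε` times a quantity
that does not depend on `ε`: the erased symbol contributes nothing. -/
theorem disc_erasure_eq {q : ℕ} (v : Fin q → ℝ) (T : Matrix (Fin q) (Fin q) ℝ)
    (hT : ∑ i, ∑ j, T i j = 0) (ν : Fin q → Fin q → ℝ) {ε : ℝ} (hε0 : 0 < ε) (hε1 : ε < 1) :
    disc v T (muEps ν ε) (fun i x => nuEps ν ε i x / muEps ν ε x) =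
      (1 - ε) * disc v T (fun x => 1 / (q : ℝ) * ∑ k, ν k x)
        (fun i x => ν i x / (1 / (q : ℝ) * ∑ k, ν k x)) := by
  have hne : 1 - ε ≠ 0 := (sub_pos.2 hε1).ne'
  have hmu (x : Fin q) :
      muEps ν ε x.castSucc = (1 - ε) * (1 / (q : ℝ) * ∑ k, ν k x) := by
    simp [muEps, mul_assoc]
  have hnu (i x : Fin q) : nuEps ν ε i x.castSucc = (1 - ε) * ν i x := by
    simp [nuEps]
  have hmu_last : muEps ν ε (Fin.last q) = ε := by simp [muEps]
  have hnu_last (i : Fin q) : nuEps ν ε i (Fin.last q) = ε := by simp [nuEps]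
  unfold disc
  rw [Fin.sum_univ_castSucc]
  simp only [hmu, hnu, hmu_last, hnu_last, mul_div_mul_left _ _ hne, div_self hε0.ne', one_mul,
    mul_one, hT, zero_mul, add_zero, Finset.mul_sum (s := Finset.univ) (a := 1 - ε)]
  exact Finset.sum_congr rfl fun x _ => mul_left_comm _ _ _

/-- **Lemma 2.9(iii)** (Janson–Mossel). Heavy erasure makes the discrepancy small: let
`ν_1, …, ν_q` be everywhere-positive probability mass functions on `{1,…,q}`. Then for every
`δ > 0` there is `ε* < 1` such that for all `ε* < ε < 1`, the densities `f^ε_i = ν^ε_i / μ^ε`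
of the erasure-perturbed measures satisfy `D(f^ε) ≤ δ`. -/
theorem disc_le_of_heavy_erasure
    (q : ℕ) (hq : 1 ≤ q) (M : Matrix (Fin q) (Fin q) ℝ)
    (hMnonneg : ∀ i j, 0 ≤ M i j)
    (hMrow : ∀ i, ∑ j, M i j = 1)
    (v : Fin q → ℝ)
    (hvpos : ∀ i, 0 < v i)
    (hvsum : ∑ i, v i = 1)
    (hstat : ∀ j, ∑ i, v i * M i j = v j)
    (T : Matrix (Fin q) (Fin q) ℝ)
    (hTsymm : ∀ i j, T i j = T j i)
    (hTpsd : ∀ b : Fin q → ℝ, 0 ≤ ∑ i, ∑ j, b i * T i j * b j)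
    (hTconst : ∀ b : Fin q → ℝ, (∑ i, ∑ j, b i * T i j * b j) = 0 ↔ ∃ c : ℝ, ∀ i, b i = c)
    (ν : Fin q → Fin q → ℝ)
    (hνpos : ∀ i j, 0 < ν i j) (hνsum : ∀ i, ∑ j, ν i j = 1)
    (δ : ℝ) (hδ : 0 < δ) :
    ∃ εstar : ℝ, εstar < 1 ∧
      ∀ ε : ℝ, εstar < ε → ε < 1 →
        disc v T (muEps ν ε) (fun i x => nuEps ν ε i x / muEps ν ε x) ≤ δ := by
  have hT : ∑ i, ∑ j, T i j = 0 := by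
    simpa using (hTconst fun _ => 1).2 ⟨1, fun _ => rfl⟩
  set C := disc v T (fun x => 1 / (q : ℝ) * ∑ k, ν k x)
    (fun i x => ν i x / (1 / (q : ℝ) * ∑ k, ν k x))
  have hC : 0 < |C| + 1 := by positivity
  refine ⟨max 0 (1 - δ / (|C| + 1)),
    max_lt one_pos (sub_lt_self _ (by positivity)), fun ε hε hε1 => ?_⟩
  obtain ⟨hε0, hεδ⟩ := max_lt_iff.1 hε
  rw [disc_erasure_eq v T hT ν hε0 hε1]
  calc (1 - ε) * C ≤ (1 - ε) * (|C| + 1) := by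
        gcongr
        linarith [le_abs_self C]
    _ ≤ δ := (le_div_iff₀ hC).1 (by linarith)
end
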